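/- arXiv:1504.08176 — 2 statements merged into one kernel-verified Lean document; each statement's English description precedes it below -/
import Mathlib

section
/- Let M be a finitely generated R-module and 0 → M →d⁰ X⁰ →d¹ X¹ →d² ⋯ a complex of finitely generated R-modules with each X^i maximal Cohen–Macaulay; put μ⁰ := d⁰ and let μ^i : coker d^{i−1} → X^i be the induced homomorphisms. If for each i ≥ 0 one has cod(ker μ^i) > i and there exists an exact sequence 0 → S^i → coker μ^i → T^i → U^i → 0 with cod S^i > i+1, cod U^i > i+2, T^i satisfying (S_2), and (T^i)† of finite injective dimension and satisfying (S_{i+3}), then the complex is a special proper CM-coresolution of M. -/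
open CategoryTheory

noncomputable section

/-- `Ext^n_A(M, N)` as a module. -/
def ext1 (A : Type) [CommRing A] (n : ℕ) (M N : Type) [AddCommGroup M] [Module A M]
    [AddCommGroup N] [Module A N] : ModuleCat A :=
  ((Ext A (ModuleCat A) n).obj (Opposite.op (ModuleCat.of A M))).obj (ModuleCat.of A N)

/-- The depth of a module over a local ring: the least `n` with `Ext^n(k, M) ≠ 0`
(`⊤` if no such `n`, e.g. for the zero module). -/
def rdepth (A : Type) [CommRing A] [IsLocalRing A] (M : Type) [AddCommGroup M] [Module A M] :
    ℕ∞ :=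
  sInf {n : ℕ∞ | ∃ m : ℕ, n = m ∧ ¬ Subsingleton (ext1 A m (IsLocalRing.ResidueField A) M)}

/-- The dimension of a module, `dim M = dim (A / ann M)`. -/
def mdim (A : Type) [CommRing A] (M : Type) [AddCommGroup M] [Module A M] : WithBot ℕ∞ :=
  ringKrullDim (A ⧸ Module.annihilator A M)

/-- `cod M > n`, i.e. `dim A - dim M > n`, i.e. `dim M + n < d`. -/
def codGT (A : Type) [CommRing A] (d : ℕ) (M : Type) [AddCommGroup M] [Module A M]
    (n : ℕ) : Prop :=
  mdim A M + n < (d : WithBot ℕ∞)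

/-- `cod M ≥ n`, i.e. `dim M + n ≤ d`. -/
def codGE (A : Type) [CommRing A] (d : ℕ) (M : Type) [AddCommGroup M] [Module A M]
    (n : ℕ) : Prop :=
  mdim A M + n ≤ (d : WithBot ℕ∞)

/-- Maximal Cohen-Macaulay module over a `d`-dimensional local ring
(the zero module counts as MCM). -/
def IsMCM (A : Type) [CommRing A] [IsLocalRing A] (d : ℕ) (M : Type) [AddCommGroup M]
    [Module A M] : Prop :=
  Module.Finite A M ∧ (d : ℕ∞) ≤ rdepth A M

/-- Serre's condition `(S_n)`: `depth M_p ≥ min {n, ht p}` for all primes `p`. -/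
def SerreS (A : Type) [CommRing A] (n : ℕ) (M : Type) [AddCommGroup M] [Module A M] : Prop :=
  ∀ p : PrimeSpectrum A,
    min (n : WithBot ℕ∞) (ringKrullDim (Localization.AtPrime p.asIdeal))
      ≤ (rdepth (Localization.AtPrime p.asIdeal)
          (LocalizedModule p.asIdeal.primeCompl M) : ℕ∞)

/-- Finite injective dimension: `Ext^m(-, M)` vanishes for all large `m`. -/
def HasFID (A : Type) [CommRing A] (M : Type) [AddCommGroup M] [Module A M] : Prop :=
  ∃ n : ℕ, ∀ (N : Type) [AddCommGroup N] [Module A N], ∀ m : ℕ, n < m →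
    Subsingleton (ext1 A m N M)

/-- `ω` is a canonical module of the `d`-dimensional local ring `A`:
it is maximal Cohen-Macaulay, of finite injective dimension, and of type one. -/
def IsCanonicalModule (A : Type) [CommRing A] [IsLocalRing A] (d : ℕ) (ω : Type)
    [AddCommGroup ω] [Module A ω] : Prop :=
  IsMCM A d ω ∧ HasFID A ω ∧
    Nonempty ((ext1 A d (IsLocalRing.ResidueField A) ω) ≃ₗ[A] IsLocalRing.ResidueField A)

/-- `μ : M → X` is a CM-preenvelope. -/
def IsCMPreenvelope (A : Type) [CommRing A] [IsLocalRing A] (d : ℕ) {M X : Type}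
    [AddCommGroup M] [Module A M] [AddCommGroup X] [Module A X] (μ : M →ₗ[A] X) : Prop :=
  IsMCM A d X ∧ ∀ (Z : Type) [AddCommGroup Z] [Module A Z], IsMCM A d Z →
    ∀ f : M →ₗ[A] Z, ∃ g : X →ₗ[A] Z, g ∘ₗ μ = f

/-- `μ : M → X` is a special CM-preenvelope: a CM-preenvelope with
`Ext^1(coker μ, Z) = 0` for all maximal Cohen-Macaulay `Z`. -/
def IsSpecialCMPreenvelope (A : Type) [CommRing A] [IsLocalRing A] (d : ℕ) {M X : Type}
    [AddCommGroup M] [Module A M] [AddCommGroup X] [Module A X] (μ : M →ₗ[A] X) : Prop :=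
  IsCMPreenvelope A d μ ∧ ∀ (Z : Type) [AddCommGroup Z] [Module A Z], IsMCM A d Z →
    Subsingleton (ext1 A 1 (X ⧸ LinearMap.range μ) Z)

/-- `μ : M → X` is a CM-envelope. -/
def IsCMEnvelope (A : Type) [CommRing A] [IsLocalRing A] (d : ℕ) {M X : Type}
    [AddCommGroup M] [Module A M] [AddCommGroup X] [Module A X] (μ : M →ₗ[A] X) : Prop :=
  IsCMPreenvelope A d μ ∧ ∀ φ : X →ₗ[A] X, φ ∘ₗ μ = μ → Function.Bijective φ

/-- `π : X → M` is a CM-precover. -/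
def IsCMPrecover (A : Type) [CommRing A] [IsLocalRing A] (d : ℕ) {X M : Type}
    [AddCommGroup X] [Module A X] [AddCommGroup M] [Module A M] (π : X →ₗ[A] M) : Prop :=
  IsMCM A d X ∧ ∀ (Z : Type) [AddCommGroup Z] [Module A Z], IsMCM A d Z →
    ∀ f : Z →ₗ[A] M, ∃ g : Z →ₗ[A] X, π ∘ₗ g = f

/-- `π : X → M` is a special CM-precover: a CM-precover with
`Ext^1(Z, ker π) = 0` for all maximal Cohen-Macaulay `Z`. -/
def IsSpecialCMPrecover (A : Type) [CommRing A] [IsLocalRing A] (d : ℕ) {X M : Type}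
    [AddCommGroup X] [Module A X] [AddCommGroup M] [Module A M] (π : X →ₗ[A] M) : Prop :=
  IsCMPrecover A d π ∧ ∀ (Z : Type) [AddCommGroup Z] [Module A Z], IsMCM A d Z →
    Subsingleton (ext1 A 1 Z ↥(LinearMap.ker π))

/-- `π : X → M` is a CM-cover. -/
def IsCMCover (A : Type) [CommRing A] [IsLocalRing A] (d : ℕ) {X M : Type}
    [AddCommGroup X] [Module A X] [AddCommGroup M] [Module A M] (π : X →ₗ[A] M) : Prop :=
  IsCMPrecover A d π ∧ ∀ φ : X →ₗ[A] X, π ∘ₗ φ = π → Function.Bijective φ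

/-- `M` has no nonzero free direct summand. -/
def NoNonzeroFreeSummand (A : Type) [CommRing A] (M : Type) [AddCommGroup M]
    [Module A M] : Prop :=
  ∀ F G : Submodule A M, IsCompl F G → Module.Free A ↥F → F = ⊥

/-- `W` belongs to `add ω`: it is a direct summand of a finite direct sum of copies of `ω`. -/
def InAdd (A : Type) [CommRing A] (ω : Type) [AddCommGroup ω] [Module A ω] (W : Type)
    [AddCommGroup W] [Module A W] : Prop :=
  ∃ (n : ℕ) (W' : ModuleCat.{0} A), Nonempty ((W × ↥W') ≃ₗ[A] (Fin n → ω))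

section delta

variable (A : Type) [CommRing A] (ω : Type) [AddCommGroup ω] [Module A ω]

/-- The natural evaluation map `δ_M : M → M†† = Hom(Hom(M, ω), ω)`. -/
def deltaMap (M : Type) [AddCommGroup M] [Module A M] :
    M →ₗ[A] ((M →ₗ[A] ω) →ₗ[A] ω) :=
  (LinearMap.id : (M →ₗ[A] ω) →ₗ[A] (M →ₗ[A] ω)).flip

/-- The dual `f† = Hom(f, ω)` of a linear map `f`. -/
def dmap {M N : Type} [AddCommGroup M] [Module A M] [AddCommGroup N] [Module A N]
    (f : M →ₗ[A] N) : (N →ₗ[A] ω) →ₗ[A] (M →ₗ[A] ω) :=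
  LinearMap.lcomp A ω f

end delta

/-- The homology `ker g / im f` at the middle spot of `M → N → P`. -/
abbrev homMod (A : Type) [CommRing A] {M N P : Type} [AddCommGroup M] [Module A M]
    [AddCommGroup N] [Module A N] [AddCommGroup P] [Module A P]
    (f : M →ₗ[A] N) (g : N →ₗ[A] P) : Type :=
  ↥(LinearMap.ker g) ⧸ Submodule.comap (LinearMap.ker g).subtype (LinearMap.range f)

end

noncomputable section Coresolution

variable (R : Type) [CommRing R] [IsLocalRing R]
  (M : Type) [AddCommGroup M] [Module R M]
  (X : ℕ → ModuleCat.{0} R)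
  (d0 : M →ₗ[R] ↥(X 0)) (dn : ∀ i, ↥(X i) →ₗ[R] ↥(X (i+1)))

/-- `coker d^{i-1}`, the source of the induced map `μ^i` (for `i = 0` it is `M`). -/
def cokerAt : ℕ → Type
  | 0 => M
  | 1 => ↥(X 0) ⧸ LinearMap.range d0
  | (i+2) => ↥(X (i+1)) ⧸ LinearMap.range (dn i)

instance cokerAtAddCommGroup : ∀ i, AddCommGroup (cokerAt R M X d0 dn i)
  | 0 => inferInstanceAs (AddCommGroup M)
  | 1 => inferInstanceAs (AddCommGroup (↥(X 0) ⧸ LinearMap.range d0))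
  | (i+2) => inferInstanceAs (AddCommGroup (↥(X (i+1)) ⧸ LinearMap.range (dn i)))

instance cokerAtModule : ∀ i, Module R (cokerAt R M X d0 dn i)
  | 0 => inferInstanceAs (Module R M)
  | 1 => inferInstanceAs (Module R (↥(X 0) ⧸ LinearMap.range d0))
  | (i+2) => inferInstanceAs (Module R (↥(X (i+1)) ⧸ LinearMap.range (dn i)))

variable (hc0 : LinearMap.range d0 ≤ LinearMap.ker (dn 0))
  (hc : ∀ i, LinearMap.range (dn i) ≤ LinearMap.ker (dn (i+1)))

/-- The induced map `μ^i : coker d^{i-1} → X^i`. -/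
def muAt : ∀ i, cokerAt R M X d0 dn i →ₗ[R] ↥(X i)
  | 0 => d0
  | 1 => Submodule.liftQ _ (dn 0) hc0
  | (i+2) => Submodule.liftQ _ (dn (i+1)) (hc i)

/-- The complex `0 → M → X⁰ → X¹ → ⋯` of maximal Cohen-Macaulay modules is a special
proper CM-coresolution of `M` if every induced map `μ^i` is a special CM-preenvelope. -/
def IsSpecialProperCMCoresolution (d : ℕ) : Prop :=
  (∀ i, IsMCM R d ↥(X i)) ∧ ∀ i, IsSpecialCMPreenvelope R d (muAt R M X d0 dn hc0 hc i)

/-- The complex `0 → M → X⁰ → X¹ → ⋯` of maximal Cohen-Macaulay modules is a minimal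
proper CM-coresolution of `M` if every induced map `μ^i` is a CM-envelope. -/
def IsMinimalProperCMCoresolution (d : ℕ) : Prop :=
  (∀ i, IsMCM R d ↥(X i)) ∧ ∀ i, IsCMEnvelope R d (muAt R M X d0 dn hc0 hc i)

end Coresolution

open CategoryTheory Abelian IsLocalRing

abbrev EE (A : Type) [CommRing A] (M N : Type) [AddCommGroup M] [Module A M]
    [AddCommGroup N] [Module A N] (n : ℕ) : Type :=
  Abelian.Ext (ModuleCat.of A M) (ModuleCat.of A N) n

section Comparison

variable {C : Type 1} [Category.{0} C] [Abelian C] [HasExt.{0} C] {X Y : C}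
  (P : ProjectiveResolution X)

lemma extMk_zero_degree_eq_zero_iff (f : P.complex.X 0 ⟶ Y) (hf : P.complex.d 1 0 ≫ f = 0) :
    P.extMk f 1 rfl hf = 0 ↔ f = 0 := by
  simp only [← P.extEquivCohomologyClass.apply_eq_iff_eq,
    P.extEquivCohomologyClass_extMk, P.extEquivCohomologyClass_zero,
    CochainComplex.HomComplex.CohomologyClass.mk_eq_zero_iff]
  rw [CochainComplex.HomComplex.Cocycle.toSingleMk_mem_coboundaries_iff _ _ _ _ _ 1 (by simp)]
  constructor
  · rintro ⟨g, hg⟩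
    rw [← cancel_epi (P.cochainComplexXIso (-0) 0 rfl).hom, Limits.comp_zero]
    have h1 : P.cochainComplex.d (-(0 : ℕ)) 1 = 0 := by
      apply Limits.IsZero.eq_of_tgt
      exact CochainComplex.isZero_of_isStrictlyLE P.cochainComplex 0 1 (by lia)
    rw [h1, Limits.zero_comp] at hg
    exact hg.symm
  · rintro rfl
    exact ⟨0, by simp⟩

end Comparison

section
variable {A : Type} [CommRing A] {X Y : ModuleCat.{0} A} (P : ProjectiveResolution X)

lemma smul_extMk {n : ℕ} (r : A) (f : P.complex.X n ⟶ Y) (m : ℕ) (hm : n + 1 = m)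
    (hf : P.complex.d m n ≫ f = 0) :
    P.extMk (r • f) m hm (by simp [hf]) = r • P.extMk f m hm hf := by
  rw [Abelian.Ext.smul_eq_comp_mk₀, P.extMk_comp_mk₀]
  simp

/-- The map sending a cocycle of `Hom(P, Y)` to the class it represents. -/
noncomputable def cocycleToExt (i n : ℕ) :
    LinearMap.ker ((P.complex.linearYonedaObj A Y).sc' i n (n + 1)).g.hom →ₗ[A]
      Abelian.Ext X Y n where
  toFun f := P.extMk (show P.complex.X n ⟶ Y from f.1) (n+1) rfl f.2
  map_add' _ _ := (P.add_extMk _ _ _ _ _ _).symm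
  map_smul' _ _ := smul_extMk P _ _ _ _ _

lemma cocycleToExt_surjective (i n : ℕ) : Function.Surjective (cocycleToExt (Y := Y) P i n) := by
  intro e
  obtain ⟨f, hf, rfl⟩ := P.extMk_surjective e (n + 1) rfl
  exact ⟨⟨f, hf⟩, rfl⟩

lemma ker_cocycleToExt (i n : ℕ) (hi : (ComplexShape.up ℕ).prev n = i) :
    LinearMap.ker (cocycleToExt (Y := Y) P i n) =
      LinearMap.range ((P.complex.linearYonedaObj A Y).sc' i n (n + 1)).moduleCatToCycles := by
  ext ⟨f, hf⟩
  have key : cocycleToExt P i n ⟨f, hf⟩ = 0 ↔ ∃ g : P.complex.X i ⟶ Y,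
      P.complex.d n i ≫ g = f := by
    rcases n with _ | n
    · obtain rfl : i = 0 := by rw [← hi]; simp
      refine (extMk_zero_degree_eq_zero_iff P f hf).trans ?_
      rw [P.complex.shape 0 0 (by simp)]
      simp only [Limits.zero_comp, exists_const]
      exact eq_comm
    · obtain rfl : i = n := by rw [← hi]; simp
      exact P.extMk_eq_zero_iff _ _ rfl hf _ rfl
  rw [LinearMap.mem_ker, key]
  constructor
  · rintro ⟨g, hg⟩
    exact ⟨g, Subtype.ext hg⟩
  · rintro ⟨g, hg⟩
    exact ⟨g, congrArg Subtype.val hg⟩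

end

/-- The derived functor `ext1` agrees with `Ext` in the derived category. -/
noncomputable def extEquiv (A : Type) [CommRing A] (n : ℕ) (M N : Type) [AddCommGroup M]
    [Module A M] [AddCommGroup N] [Module A N] : ext1 A n M N ≃ₗ[A] EE A M N n :=
  let P := ProjectiveResolution.of (ModuleCat.of A M)
  let K := P.complex.linearYonedaObj A (ModuleCat.of A N)
  let i := (ComplexShape.up ℕ).prev n
  (P.isoExt n (ModuleCat.of A N) ≪≫ K.homologyIsoSc' i n (n + 1) rfl (by simp) ≪≫
    (K.sc' i n (n + 1)).moduleCatHomologyIso).toLinearEquiv ≪≫ₗ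
  (Submodule.quotEquivOfEq _ _ (ker_cocycleToExt P i n rfl).symm) ≪≫ₗ
  (cocycleToExt P i n).quotKerEquivOfSurjective (cocycleToExt_surjective P i n)

lemma subsingleton_ext1_iff (A : Type) [CommRing A] (n : ℕ) (M N : Type) [AddCommGroup M]
    [Module A M] [AddCommGroup N] [Module A N] :
    Subsingleton (ext1 A n M N) ↔ Subsingleton (EE A M N n) :=
  (extEquiv A n M N).toEquiv.subsingleton_congr

section LES

variable {A : Type} [CommRing A]

/-- `0 → M → N → P → 0` is a short exact sequence. -/
structure SES {M N P : Type} [AddCommGroup M] [Module A M] [AddCommGroup N] [Module A N]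
    [AddCommGroup P] [Module A P] (f : M →ₗ[A] N) (g : N →ₗ[A] P) : Prop where
  inj : Function.Injective f
  exact : Function.Exact f g
  surj : Function.Surjective g

variable {M N P Q : Type} [AddCommGroup M] [Module A M] [AddCommGroup N] [Module A N]
    [AddCommGroup P] [Module A P] [AddCommGroup Q] [Module A Q]
  {X Y : Type} [AddCommGroup X] [Module A X] [AddCommGroup Y] [Module A Y]

/-- Functoriality of `Ext` in the first variable. -/
noncomputable def extL (Y : Type) [AddCommGroup Y] [Module A Y] (f : M →ₗ[A] N) (n : ℕ) :
    EE A N Y n →ₗ[A] EE A M Y n :=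
  (Ext.mk₀ (ModuleCat.ofHom f)).precompOfLinear A (ModuleCat.of A Y) (zero_add n)

/-- Functoriality of `Ext` in the second variable. -/
noncomputable def extR (X : Type) [AddCommGroup X] [Module A X] (f : M →ₗ[A] N) (n : ℕ) :
    EE A X M n →ₗ[A] EE A X N n :=
  (Ext.mk₀ (ModuleCat.ofHom f)).postcompOfLinear A (ModuleCat.of A X) (add_zero n)

lemma extL_apply (f : M →ₗ[A] N) (n : ℕ) (e : EE A N Y n) :
    extL Y f n e = (Ext.mk₀ (ModuleCat.ofHom f)).comp e (zero_add n) := rfl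

lemma extR_apply (f : M →ₗ[A] N) (n : ℕ) (e : EE A X M n) :
    extR X f n e = e.comp (Ext.mk₀ (ModuleCat.ofHom f)) (add_zero n) := rfl

lemma extL_extL (f : M →ₗ[A] N) (g : N →ₗ[A] P) (n : ℕ) (e : EE A P Y n) :
    extL Y f n (extL Y g n e) = extL Y (g ∘ₗ f) n e := by
  simp [extL_apply, ModuleCat.ofHom_comp]

lemma extR_extR (f : M →ₗ[A] N) (g : N →ₗ[A] P) (n : ℕ) (e : EE A X M n) :
    extR X g n (extR X f n e) = extR X (g ∘ₗ f) n e := by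
  simp [extR_apply, ModuleCat.ofHom_comp]

lemma extL_id (n : ℕ) (e : EE A M Y n) : extL Y LinearMap.id n e = e :=
  Ext.mk₀_id_comp e

lemma extR_id (n : ℕ) (e : EE A X M n) : extR X LinearMap.id n e = e :=
  Ext.comp_mk₀_id e

lemma extL_smul (r : A) (f : M →ₗ[A] N) (n : ℕ) (e : EE A N Y n) :
    extL Y (r • f) n e = r • extL Y f n e := by
  have : ModuleCat.ofHom (r • f) = r • ModuleCat.ofHom f := rfl
  simp [extL_apply, this, Ext.mk₀_smul]

lemma extR_smul (r : A) (f : M →ₗ[A] N) (n : ℕ) (e : EE A X M n) :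
    extR X (r • f) n e = r • extR X f n e := by
  have : ModuleCat.ofHom (r • f) = r • ModuleCat.ofHom f := rfl
  simp [extR_apply, this, Ext.mk₀_smul]

lemma extL_lsmul (r : A) (n : ℕ) (e : EE A M Y n) :
    extL Y (LinearMap.lsmul A M r) n e = r • e := by
  have : LinearMap.lsmul A M r = r • LinearMap.id := by ext; simp
  rw [this, extL_smul, extL_id]

lemma extR_lsmul (r : A) (n : ℕ) (e : EE A X M n) :
    extR X (LinearMap.lsmul A M r) n e = r • e := by
  have : LinearMap.lsmul A M r = r • LinearMap.id := by ext; simp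
  rw [this, extR_smul, extR_id]

lemma extL_zero (n : ℕ) (e : EE A N Y n) : extL Y (0 : M →ₗ[A] N) n e = 0 := by
  have := extL_smul (0 : A) (0 : M →ₗ[A] N) n e
  simpa using this

lemma extR_zero (n : ℕ) (e : EE A X M n) : extR X (0 : M →ₗ[A] N) n e = 0 := by
  have := extR_smul (0 : A) (0 : M →ₗ[A] N) n e
  simpa using this

/-- Invariance of `Ext` under isomorphism in the first variable. -/
noncomputable def extLEquiv (Y : Type) [AddCommGroup Y] [Module A Y] (f : M ≃ₗ[A] N) (n : ℕ) :
    EE A N Y n ≃ₗ[A] EE A M Y n :=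
  LinearEquiv.ofLinearMap (extL Y f.toLinearMap n) (extL Y f.symm.toLinearMap n)
    (by ext e; simp [extL_extL, extL_id])
    (by ext e; simp [extL_extL, extL_id])

/-- Invariance of `Ext` under isomorphism in the second variable. -/
noncomputable def extREquiv (X : Type) [AddCommGroup X] [Module A X] (f : M ≃ₗ[A] N) (n : ℕ) :
    EE A X M n ≃ₗ[A] EE A X N n :=
  LinearEquiv.ofLinearMap (extR X f.toLinearMap n) (extR X f.symm.toLinearMap n)
    (by ext e; simp [extR_extR, extR_id])
    (by ext e; simp [extR_extR, extR_id])

/-- `Ext⁰` is `Hom`. -/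
noncomputable def homEquivExt (M N : Type) [AddCommGroup M] [Module A M] [AddCommGroup N]
    [Module A N] : (M →ₗ[A] N) ≃ₗ[A] EE A M N 0 :=
  (Ext.linearEquiv₀.trans ModuleCat.homLinearEquiv).symm

lemma homEquivExt_apply (f : M →ₗ[A] N) : homEquivExt M N f = Ext.mk₀ (ModuleCat.ofHom f) := by
  simp [homEquivExt]
  rfl

lemma extL_homEquivExt (f : M →ₗ[A] N) (h : N →ₗ[A] Y) :
    extL Y f 0 (homEquivExt N Y h) = homEquivExt M Y (h ∘ₗ f) := by
  simp [extL_apply, homEquivExt_apply, ModuleCat.ofHom_comp]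

lemma extR_homEquivExt (f : M →ₗ[A] N) (h : X →ₗ[A] M) :
    extR X f 0 (homEquivExt X M h) = homEquivExt X N (f ∘ₗ h) := by
  simp [extR_apply, homEquivExt_apply, ModuleCat.ofHom_comp]

lemma ext_subsingleton_of_projective [Module.Projective A M] (n : ℕ) :
    Subsingleton (EE A M Y (n+1)) := by
  have : CategoryTheory.Projective (ModuleCat.of A M) := inferInstance
  exact Ext.subsingleton_of_projective _ _ _

lemma ext_subsingleton_left [Subsingleton M] (n : ℕ) : Subsingleton (EE A M Y n) := by
  constructor
  intro a b
  have : (LinearMap.id : M →ₗ[A] M) = 0 := LinearMap.ext fun x => Subsingleton.elim _ _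
  rw [← extL_id n a, ← extL_id n b, this, extL_zero, extL_zero]

lemma ext_subsingleton_right [Subsingleton M] (n : ℕ) : Subsingleton (EE A X M n) := by
  constructor
  intro a b
  have : (LinearMap.id : M →ₗ[A] M) = 0 := LinearMap.ext fun x => Subsingleton.elim _ _
  rw [← extR_id n a, ← extR_id n b, this, extR_zero, extR_zero]

section

variable {f : M →ₗ[A] N} {g : N →ₗ[A] P} (h : SES f g)
include h

lemma SES.comp_eq_zero : g ∘ₗ f = 0 := h.exact.linearMap_comp_eq_zero

lemma SES.shortExact : (ShortComplex.mk (ModuleCat.ofHom f) (ModuleCat.ofHom g)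
    (by rw [← ModuleCat.ofHom_comp, h.comp_eq_zero]; rfl)).ShortExact :=
  ModuleCat.shortComplex_shortExact _ h.exact h.inj h.surj

/-- The connecting map in the first variable. -/
noncomputable def SES.deltaL (Y : Type) [AddCommGroup Y] [Module A Y] (n : ℕ) :
    EE A M Y n →ₗ[A] EE A P Y (n + 1) :=
  h.shortExact.extClass.precompOfLinear A (ModuleCat.of A Y) (add_comm 1 n)

/-- The connecting map in the second variable. -/
noncomputable def SES.deltaR (X : Type) [AddCommGroup X] [Module A X] (n : ℕ) :
    EE A X P n →ₗ[A] EE A X M (n + 1) :=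
  h.shortExact.extClass.postcompOfLinear A (ModuleCat.of A X) rfl

lemma SES.deltaR_extL (u : X →ₗ[A] Y) (n : ℕ) (e : EE A Y P n) :
    h.deltaR X n (extL P u n e) = extL M u (n + 1) (h.deltaR Y n e) := by
  exact Ext.comp_assoc _ _ _ (zero_add n) (rfl : n + 1 = n + 1) (by lia)

lemma SES.exactL₂ (Y : Type) [AddCommGroup Y] [Module A Y] (n : ℕ) :
    Function.Exact (extL Y g n) (extL Y f n) := by
  intro e
  constructor
  · intro he
    exact Ext.contravariant_sequence_exact₂ h.shortExact _ e he
  · rintro ⟨e, rfl⟩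
    rw [extL_extL, h.comp_eq_zero, extL_zero]

lemma SES.exactL₁ (Y : Type) [AddCommGroup Y] [Module A Y] (n : ℕ) :
    Function.Exact (extL Y f n) (h.deltaL Y n) := by
  intro e
  constructor
  · intro he
    exact Ext.contravariant_sequence_exact₁ h.shortExact _ e (add_comm 1 n) he
  · rintro ⟨e, rfl⟩
    exact h.shortExact.extClass_comp_assoc _ (h := add_comm 1 n)

lemma SES.exactL₃ (Y : Type) [AddCommGroup Y] [Module A Y] (n : ℕ) :
    Function.Exact (h.deltaL Y n) (extL Y g (n + 1)) := by
  intro e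
  constructor
  · intro he
    exact Ext.contravariant_sequence_exact₃ h.shortExact _ e he (add_comm 1 n)
  · rintro ⟨e, rfl⟩
    exact h.shortExact.comp_extClass_assoc _ (add_comm 1 n)

lemma SES.injL (Y : Type) [AddCommGroup Y] [Module A Y] : Function.Injective (extL Y g 0) := by
  rw [injective_iff_map_eq_zero]
  intro e he
  obtain ⟨e, rfl⟩ := (homEquivExt P Y).surjective e
  rw [extL_homEquivExt, LinearEquiv.map_eq_zero_iff] at he
  rw [LinearEquiv.map_eq_zero_iff]
  ext x
  obtain ⟨x, rfl⟩ := h.surj x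
  exact DFunLike.congr_fun he x

lemma SES.exactR₂ (X : Type) [AddCommGroup X] [Module A X] (n : ℕ) :
    Function.Exact (extR X f n) (extR X g n) := by
  intro e
  constructor
  · intro he
    exact Ext.covariant_sequence_exact₂ _ h.shortExact e he
  · rintro ⟨e, rfl⟩
    rw [extR_extR, h.comp_eq_zero, extR_zero]

lemma SES.exactR₃ (X : Type) [AddCommGroup X] [Module A X] (n : ℕ) :
    Function.Exact (extR X g n) (h.deltaR X n) := by
  intro e
  constructor
  · intro he
    exact Ext.covariant_sequence_exact₃ _ h.shortExact e rfl he
  · rintro ⟨e, rfl⟩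
    refine (Ext.comp_assoc _ _ _ (add_zero n) (zero_add 1) (by lia)).trans ?_
    rw [h.shortExact.comp_extClass, Ext.comp_zero]

lemma SES.exactR₁ (X : Type) [AddCommGroup X] [Module A X] (n : ℕ) :
    Function.Exact (h.deltaR X n) (extR X f (n + 1)) := by
  intro e
  constructor
  · intro he
    exact Ext.covariant_sequence_exact₁ _ h.shortExact e he rfl
  · rintro ⟨e, rfl⟩
    refine (Ext.comp_assoc _ _ _ rfl (add_zero 1) (by lia)).trans ?_
    rw [h.shortExact.extClass_comp, Ext.comp_zero]

end

lemma SES.of_submodule (K : Submodule A M) : SES K.subtype K.mkQ :=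
  ⟨K.injective_subtype, LinearMap.exact_subtype_mkQ K, K.mkQ_surjective⟩

lemma SES.of_surjective {f : M →ₗ[A] N} (hf : Function.Surjective f) :
    SES (LinearMap.ker f).subtype f :=
  ⟨Submodule.injective_subtype _, f.exact_subtype_ker_map, hf⟩

lemma SES.of_injective {f : M →ₗ[A] N} (hf : Function.Injective f) :
    SES f (LinearMap.range f).mkQ :=
  ⟨hf, LinearMap.exact_map_mkQ_range f, Submodule.mkQ_surjective _⟩

end LES

section PZ

variable {A : Type} [CommRing A]

/-- The localization of `E` at the prime `p` vanishes. -/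
def PZ (p : Ideal A) (E : Type) [AddCommGroup E] [Module A E] : Prop :=
  ∀ e : E, ∃ s : A, s ∉ p ∧ s • e = 0

variable {p : Ideal A} {E E' E'' : Type} [AddCommGroup E] [Module A E]
  [AddCommGroup E'] [Module A E'] [AddCommGroup E''] [Module A E'']

lemma PZ.of_subsingleton [hp : p.IsPrime] [Subsingleton E] : PZ p E :=
  fun _ => ⟨1, hp.one_notMem, Subsingleton.elim _ _⟩

lemma PZ.of_injective (f : E →ₗ[A] E') (hf : Function.Injective f) (h : PZ p E') : PZ p E := by
  intro e
  obtain ⟨s, hs, hse⟩ := h (f e)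
  exact ⟨s, hs, hf (by rw [map_smul, hse, map_zero])⟩

lemma PZ.of_surjective (f : E →ₗ[A] E') (hf : Function.Surjective f) (h : PZ p E) : PZ p E' := by
  intro e
  obtain ⟨e, rfl⟩ := hf e
  obtain ⟨s, hs, hse⟩ := h e
  exact ⟨s, hs, by rw [← map_smul, hse, map_zero]⟩

lemma PZ.of_equiv (f : E ≃ₗ[A] E') (h : PZ p E) : PZ p E' :=
  h.of_surjective f.toLinearMap f.surjective

lemma PZ.of_exact [hp : p.IsPrime] {f : E →ₗ[A] E'} {g : E' →ₗ[A] E''} (hfg : Function.Exact f g)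
    (h : PZ p E) (h' : PZ p E'') : PZ p E' := by
  intro e
  obtain ⟨s, hs, hse⟩ := h' (g e)
  rw [← map_smul, hfg] at hse
  obtain ⟨e', he'⟩ := hse
  obtain ⟨t, ht, hte⟩ := h e'
  refine ⟨t * s, fun h => (hp.mem_or_mem h).elim ht hs, ?_⟩
  rw [mul_smul, ← he', ← map_smul, hte, map_zero]

lemma PZ.exists_smul [hp : p.IsPrime] [Module.Finite A E] (h : PZ p E) :
    ∃ s : A, s ∉ p ∧ ∀ e : E, s • e = 0 := by
  obtain ⟨S, hS⟩ := Module.Finite.fg_top (R := A) (M := E)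
  choose s hs hse using h
  refine ⟨∏ e ∈ S, s e, fun h => ?_, fun e => ?_⟩
  · obtain ⟨e, -, he⟩ := hp.prod_mem_iff.mp h
    exact hs e he
  · have : e ∈ Submodule.span A (S : Set E) := hS ▸ Submodule.mem_top
    induction this using Submodule.span_induction with
    | mem x hx =>
      obtain ⟨c, hc⟩ := Finset.dvd_prod_of_mem s hx
      rw [hc, mul_comm, mul_smul, hse, smul_zero]
    | zero => simp
    | add x y _ _ hx hy => simp [hx, hy]
    | smul a x _ hx => rw [smul_comm, hx, smul_zero]

lemma PZ.of_smul (s : A) (hs : s ∉ p) (h : ∀ e : E, s • e = 0) : PZ p E := fun e => ⟨s, hs, h e⟩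

lemma PZ.subsingleton [IsLocalRing A] (h : PZ (IsLocalRing.maximalIdeal A) E) :
    Subsingleton E := by
  refine subsingleton_of_forall_eq 0 fun e => ?_
  obtain ⟨s, hs, hse⟩ := h e
  have hu : IsUnit s := by simpa using hs
  simpa using (hu.smul_eq_zero).mp hse

lemma PZ.nakayama [hp : p.IsPrime] [Module.Finite A E] {x : A} (hx : x ∈ p)
    (h : ∀ e : E, ∃ s : A, s ∉ p ∧ ∃ e', s • e = x • e') : PZ p E := by
  have h1 : PZ p (E ⧸ (Ideal.span {x} • ⊤ : Submodule A E)) := by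
    intro e
    obtain ⟨e, rfl⟩ := Submodule.mkQ_surjective _ e
    obtain ⟨s, hs, e', he'⟩ := h e
    refine ⟨s, hs, ?_⟩
    rw [← map_smul, he', Submodule.mkQ_apply, Submodule.Quotient.mk_eq_zero]
    exact Submodule.smul_mem_smul (Ideal.mem_span_singleton_self x) trivial
  obtain ⟨s, hs, hse⟩ := h1.exists_smul
  obtain ⟨P, hP, hdeg, hco, hev⟩ :=
    LinearMap.exists_monic_and_natDegree_eq_and_coeff_mem_pow_and_aeval_eq_zero A
      (LinearMap.lsmul A E s) (Ideal.span {x}) (by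
        rintro _ ⟨e, rfl⟩
        have := hse (Submodule.Quotient.mk e)
        rwa [← Submodule.Quotient.mk_smul, Submodule.Quotient.mk_eq_zero] at this)
  have key : ∀ Q : Polynomial A, ∀ e : E,
      Polynomial.aeval (LinearMap.lsmul A E s) Q e = Q.eval s • e := by
    intro Q e
    induction Q using Polynomial.induction_on' with
    | add a b ha hb => simp [ha, hb, add_smul]
    | monomial n a =>
      simp only [Polynomial.aeval_monomial, Polynomial.eval_monomial, Module.End.mul_apply,
        Module.algebraMap_end_apply, mul_smul]
      congr 1
      induction n with
      | zero => simp
      | succ n ih =>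
        rw [pow_succ', Module.End.mul_apply, ih, pow_succ', mul_smul, LinearMap.lsmul_apply]
  refine PZ.of_smul (P.eval s) (fun hmem => ?_) fun e => by rw [← key, hev]; rfl
  rw [Polynomial.eval_eq_sum_range, Finset.sum_range_succ, hP.coeff_natDegree, one_mul] at hmem
  refine hs (hp.mem_of_pow_mem _ ((p.add_mem_iff_right ?_).mp hmem))
  refine p.sum_mem fun k hk => p.mul_mem_right _ ?_
  have h2 : (Ideal.span {x} : Ideal A) ≤ p := by simpa [Ideal.span_singleton_le_iff_mem] using hx
  refine h2 (Ideal.pow_le_self ?_ (hco k))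
  have := Finset.mem_range.mp hk
  lia

section

variable {M N P : Type} [AddCommGroup M] [Module A M] [AddCommGroup N] [Module A N]
    [AddCommGroup P] [Module A P] {f : M →ₗ[A] N} {g : N →ₗ[A] P} (h : SES f g)
  (X : Type) [AddCommGroup X] [Module A X]
include h

lemma SES.pzL₁ [p.IsPrime] (n : ℕ) (h1 : PZ p (EE A N X n)) (h2 : PZ p (EE A P X (n + 1))) :
    PZ p (EE A M X n) := h1.of_exact (h.exactL₁ X n) h2

lemma SES.pzL₂ [p.IsPrime] (n : ℕ) (h1 : PZ p (EE A M X n)) (h2 : PZ p (EE A P X n)) :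
    PZ p (EE A N X n) := h2.of_exact (h.exactL₂ X n) h1

omit h in
lemma subsingleton_of_exact {f : E →ₗ[A] E'} {g : E' →ₗ[A] E''} (hfg : Function.Exact f g)
    (h : Subsingleton E) (h' : Subsingleton E'') : Subsingleton E' := by
  refine subsingleton_of_forall_eq 0 fun e => ?_
  obtain ⟨e, rfl⟩ := (hfg e).mp (Subsingleton.elim _ _)
  rw [Subsingleton.elim e 0, map_zero]

lemma SES.ssL₁ (n : ℕ) (h1 : Subsingleton (EE A N X n)) (h2 : Subsingleton (EE A P X (n + 1))) :
    Subsingleton (EE A M X n) := subsingleton_of_exact (h.exactL₁ X n) h1 h2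

lemma SES.ssL₂ (n : ℕ) (h1 : Subsingleton (EE A M X n)) (h2 : Subsingleton (EE A P X n)) :
    Subsingleton (EE A N X n) := subsingleton_of_exact (h.exactL₂ X n) h2 h1

lemma SES.ssL₃ (n : ℕ) (h1 : Subsingleton (EE A M X n)) (h2 : Subsingleton (EE A N X (n + 1))) :
    Subsingleton (EE A P X (n + 1)) := subsingleton_of_exact (h.exactL₃ X n) h1 h2

lemma SES.ssR₁ (n : ℕ) (h1 : Subsingleton (EE A X P n)) (h2 : Subsingleton (EE A X N (n + 1))) :
    Subsingleton (EE A X M (n + 1)) := subsingleton_of_exact (h.exactR₁ X n) h1 h2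

lemma SES.ssR₂ (n : ℕ) (h1 : Subsingleton (EE A X M n)) (h2 : Subsingleton (EE A X P n)) :
    Subsingleton (EE A X N n) := subsingleton_of_exact (h.exactR₂ X n) h1 h2

lemma SES.ssR₃ (n : ℕ) (h1 : Subsingleton (EE A X N n)) (h2 : Subsingleton (EE A X M (n + 1))) :
    Subsingleton (EE A X P n) := subsingleton_of_exact (h.exactR₃ X n) h1 h2

end

variable [IsNoetherianRing A]

lemma SES.pz_of_regular [hp : p.IsPrime] {N C W : Type} [AddCommGroup N] [Module A N]
    [AddCommGroup C] [Module A C] [AddCommGroup W] [Module A W]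
    [Module.Finite A N] [Module.Finite A W] {x : A} (hx : x ∈ p) {g : N →ₗ[A] C}
    (h : SES (LinearMap.lsmul A N x) g) (n : ℕ) (hC : PZ p (EE A C W (n + 1))) :
    PZ p (EE A N W n) := by
  refine PZ.nakayama hx fun e => ?_
  obtain ⟨s, hs, hse⟩ := hC (h.deltaL W n e)
  rw [← map_smul, h.exactL₁ W n] at hse
  obtain ⟨e', he'⟩ := hse
  exact ⟨s, hs, e', by rw [← he', extL_lsmul]⟩

end PZ

section Devissage

variable {A : Type} [CommRing A] [IsNoetherianRing A]

/-- Dévissage for finitely generated modules, keeping track of the support. -/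
theorem devissage (P : (N : Type) → [AddCommGroup N] → [Module A N] → Prop)
    (zero : ∀ (N : Type) [AddCommGroup N] [Module A N] [Subsingleton N], P N)
    (extn : ∀ (N₁ N₂ N₃ : Type) [AddCommGroup N₁] [Module A N₁] [AddCommGroup N₂] [Module A N₂]
      [AddCommGroup N₃] [Module A N₃] (f : N₁ →ₗ[A] N₂) (g : N₂ →ₗ[A] N₃), SES f g →
      P N₁ → P N₃ → P N₂)
    (N : Type) [AddCommGroup N] [Module A N] [Module.Finite A N]
    (quot : ∀ q : PrimeSpectrum A, Module.annihilator A N ≤ q.asIdeal →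
      ∀ (Q : Type) [AddCommGroup Q] [Module A Q], (Q ≃ₗ[A] A ⧸ q.asIdeal) → P Q) : P N := by
  suffices h : ∀ I : Ideal A, (∀ q : PrimeSpectrum A, I ≤ q.asIdeal →
      ∀ (Q : Type) [AddCommGroup Q] [Module A Q], (Q ≃ₗ[A] A ⧸ q.asIdeal) → P Q) →
      I ≤ Module.annihilator A N → P N from h _ quot le_rfl
  intro I hI
  clear quot
  induction ‹Module.Finite A N› using
    IsNoetherianRing.induction_on_isQuotientEquivQuotientPrime A with
  | subsingleton N => exact fun _ => zero N
  | quotient N q e =>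
    intro h
    refine hI q ?_ N e
    rwa [e.annihilator_eq, Ideal.annihilator_quotient] at h
  | exact N₁ N₂ N₃ f g hf hg hfg h₁ h₃ =>
    exact fun h => extn N₁ N₂ N₃ f g ⟨hf, hfg, hg⟩
      (h₁ (h.trans (f.annihilator_le_of_injective hf)))
      (h₃ (h.trans (g.annihilator_le_of_surjective hg)))

end Devissage

section Heights

variable {R : Type} [CommRing R]

/-- The height of a prime, as a natural number. -/
noncomputable def hgt (q : PrimeSpectrum R) : ℕ := (Order.height q).toNat

/-- The coheight of a prime, as a natural number. -/
noncomputable def chgt (q : PrimeSpectrum R) : ℕ := (Order.coheight q).toNat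

variable {d : ℕ} (hdim : ringKrullDim R = d)
include hdim

lemma finite_of_dim : FiniteRingKrullDim R :=
  finiteRingKrullDim_iff_ne_bot_and_top.mpr ⟨by simp [hdim], by
    rw [hdim]; exact fun h => ENat.natCast_ne_top d (WithBot.coe_injective h)⟩

lemma coe_hgt (q : PrimeSpectrum R) : (hgt q : ℕ∞) = Order.height q := by
  have := finite_of_dim hdim
  refine ENat.natCast_toNat (lt_top_iff_ne_top.mp ?_)
  rw [← WithBot.coe_lt_coe]
  refine (Order.height_le_krullDim q).trans_lt ?_
  simpa using Order.krullDim_ne_top_of_finiteDimensionalOrder.lt_top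

lemma coe_chgt (q : PrimeSpectrum R) : (chgt q : ℕ∞) = Order.coheight q := by
  have := finite_of_dim hdim
  exact ENat.natCast_toNat (Order.coheight_lt_top q).ne

lemma hgt_add_chgt_le (q : PrimeSpectrum R) : hgt q + chgt q ≤ d := by
  have : Nonempty (PrimeSpectrum R) := ⟨q⟩
  have h := Order.krullDim_eq_iSup_height_add_coheight_of_nonempty (α := PrimeSpectrum R)
  have h2 : Order.height q + Order.coheight q ≤
      ⨆ a : PrimeSpectrum R, Order.height a + Order.coheight a :=
    le_iSup (fun a : PrimeSpectrum R => Order.height a + Order.coheight a) q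
  rw [← coe_hgt hdim, ← coe_chgt hdim] at h2
  have h3 : ((hgt q + chgt q : ℕ) : WithBot ℕ∞) ≤ d := by
    rw [← hdim, ringKrullDim, h]
    exact_mod_cast h2
  exact_mod_cast h3

lemma hgt_le (q : PrimeSpectrum R) : hgt q ≤ d := by have := hgt_add_chgt_le hdim q; lia

lemma hgt_lt {q q' : PrimeSpectrum R} (h : q < q') : hgt q < hgt q' := by
  have := Order.height_add_one_le h
  rw [← coe_hgt hdim, ← coe_hgt hdim] at this
  have h2 : hgt q + 1 ≤ hgt q' := by exact_mod_cast this
  exact h2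

lemma chgt_lt {q q' : PrimeSpectrum R} (h : q < q') : chgt q' < chgt q := by
  have := Order.coheight_add_one_le h
  rw [← coe_chgt hdim, ← coe_chgt hdim] at this
  have h2 : chgt q' + 1 ≤ chgt q := by exact_mod_cast this
  exact h2

lemma hgt_mono {q q' : PrimeSpectrum R} (h : q ≤ q') : hgt q ≤ hgt q' := by
  rcases h.eq_or_lt with rfl | h
  · rfl
  · exact (hgt_lt hdim h).le

lemma hgt_closedPoint [IsLocalRing R] : hgt (IsLocalRing.closedPoint R) = d := by
  have h : (Order.height (IsLocalRing.closedPoint R) : WithBot ℕ∞) = d := by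
    rw [← hdim, ← IsLocalRing.maximalIdeal_height_eq_ringKrullDim]
    exact congrArg _ ((PrimeSpectrum.height_eq_orderHeight _).symm)
  rw [← coe_hgt hdim] at h
  exact_mod_cast h

lemma ringKrullDim_atPrime (q : PrimeSpectrum R) :
    ringKrullDim (Localization.AtPrime q.asIdeal) = hgt q := by
  rw [IsLocalization.AtPrime.ringKrullDim_eq_height q.asIdeal, PrimeSpectrum.height_eq_orderHeight,
    ← coe_hgt hdim]
  rfl

lemma chgt_add_lt_of_mdim {N : Type} [AddCommGroup N] [Module R N] {n : ℕ}
    (h : mdim R N + n < (d : WithBot ℕ∞)) {q : PrimeSpectrum R}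
    (hq : Module.annihilator R N ≤ q.asIdeal) : chgt q + n < d := by
  have h1 : (Order.coheight q : WithBot ℕ∞) ≤ mdim R N := by
    rw [Order.coheight_eq_krullDim_Ici, mdim, ringKrullDim]
    have key : ∀ x : Set.Ici q, ∀ a ∈ Module.annihilator R N, Ideal.Quotient.mk x.1.asIdeal a = 0 :=
      fun x a ha => Ideal.Quotient.eq_zero_iff_mem.mpr (x.2 (hq ha))
    refine Order.krullDim_le_of_strictMono (fun x => ⟨RingHom.ker
      (Ideal.Quotient.lift _ (Ideal.Quotient.mk x.1.asIdeal) (key x)), RingHom.ker_isPrime _⟩) ?_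
    intro x y hxy
    have hiff : ∀ (x : Set.Ici q) (a : R), Ideal.Quotient.mk _ a ∈ RingHom.ker
      (Ideal.Quotient.lift _ (Ideal.Quotient.mk x.1.asIdeal) (key x)) ↔ a ∈ x.1.asIdeal := by
      intro x a
      rw [RingHom.mem_ker, Ideal.Quotient.lift_mk, Ideal.Quotient.eq_zero_iff_mem]
    refine lt_of_le_not_ge (fun a ha => ?_) (fun hle => hxy.not_ge fun a ha => ?_)
    · obtain ⟨a, rfl⟩ := Ideal.Quotient.mk_surjective a
      exact (hiff _ _).mpr (hxy.le ((hiff _ _).mp ha))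
    · exact (hiff x a).mp (hle ((hiff y a).mpr ha))
  rw [← coe_chgt hdim] at h1
  have h2 : ((chgt q + n : ℕ) : WithBot ℕ∞) < d := by
    refine lt_of_le_of_lt ?_ h
    push_cast
    exact add_le_add_left h1 _
  exact_mod_cast h2

end Heights

section

variable {A : Type} [CommRing A]

/-- The residue field as a quotient. -/
noncomputable def residueFieldEquiv (A : Type) [CommRing A] [IsLocalRing A] :
    (A ⧸ IsLocalRing.maximalIdeal A) ≃ₗ[A] IsLocalRing.ResidueField A where
  __ := AddEquiv.refl (A ⧸ IsLocalRing.maximalIdeal A)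
  map_smul' _ _ := rfl

lemma ext_subsingleton_congr_left {M N Y : Type} [AddCommGroup M] [Module A M] [AddCommGroup N]
    [Module A N] [AddCommGroup Y] [Module A Y] (f : M ≃ₗ[A] N) (n : ℕ) :
    Subsingleton (EE A M Y n) ↔ Subsingleton (EE A N Y n) :=
  (extLEquiv Y f n).symm.toEquiv.subsingleton_congr

lemma ext_subsingleton_congr_right {M N Y : Type} [AddCommGroup M] [Module A M] [AddCommGroup N]
    [Module A N] [AddCommGroup Y] [Module A Y] (f : M ≃ₗ[A] N) (n : ℕ) :
    Subsingleton (EE A Y M n) ↔ Subsingleton (EE A Y N n) :=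
  (extREquiv Y f n).toEquiv.subsingleton_congr

lemma pz_congr_left {M N Y : Type} [AddCommGroup M] [Module A M] [AddCommGroup N]
    [Module A N] [AddCommGroup Y] [Module A Y] (f : M ≃ₗ[A] N) {p : Ideal A} {n : ℕ}
    (h : PZ p (EE A N Y n)) : PZ p (EE A M Y n) :=
  h.of_equiv (extLEquiv Y f n)

/-- The quotient `N / xN`. -/
abbrev modX (N : Type) [AddCommGroup N] [Module A N] (x : A) : Type :=
  N ⧸ LinearMap.range (LinearMap.lsmul A N x)

lemma SES.of_regular {N : Type} [AddCommGroup N] [Module A N] {x : A}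
    (h : ∀ n : N, x • n = 0 → n = 0) :
    SES (LinearMap.lsmul A N x) (LinearMap.range (LinearMap.lsmul A N x)).mkQ :=
  .of_injective ((injective_iff_map_eq_zero _).mpr h)

lemma annihilator_le_modX (N : Type) [AddCommGroup N] [Module A N] (x : A) :
    Module.annihilator A N ≤ Module.annihilator A (modX N x) :=
  (Submodule.mkQ _).annihilator_le_of_surjective (Submodule.mkQ_surjective _)

lemma mem_annihilator_modX (N : Type) [AddCommGroup N] [Module A N] (x : A) :
    x ∈ Module.annihilator A (modX N x) := by
  rw [Module.mem_annihilator]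
  intro m
  obtain ⟨m, rfl⟩ := Submodule.mkQ_surjective _ m
  rw [← map_smul, Submodule.mkQ_apply, Submodule.Quotient.mk_eq_zero]
  exact ⟨m, rfl⟩

lemma lt_of_annihilator_modX_le {q q' : PrimeSpectrum A} {x : A} (hx : x ∉ q.asIdeal)
    (h : Module.annihilator A (modX (A ⧸ q.asIdeal) x) ≤ q'.asIdeal) : q < q' := by
  have h1 : q ≤ q' := by
    have := (annihilator_le_modX (A ⧸ q.asIdeal) x).trans h
    rwa [Ideal.annihilator_quotient] at this
  refine lt_of_le_of_ne h1 ?_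
  rintro rfl
  exact hx (h (mem_annihilator_modX _ x))

lemma SES.of_notMem (q : PrimeSpectrum A) {x : A} (hx : x ∉ q.asIdeal) :
    SES (LinearMap.lsmul A (A ⧸ q.asIdeal) x)
      (LinearMap.range (LinearMap.lsmul A (A ⧸ q.asIdeal) x)).mkQ := by
  refine .of_regular fun n hn => ?_
  obtain ⟨n, rfl⟩ := Ideal.Quotient.mk_surjective n
  change Ideal.Quotient.mk _ (x * n) = 0 at hn
  rw [Ideal.Quotient.eq_zero_iff_mem] at hn ⊢
  exact (q.2.mem_or_mem hn).resolve_left hx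

end

section Ischebeck

variable {R : Type} [CommRing R] [IsNoetherianRing R] [IsLocalRing R]
  {d : ℕ} (hdim : ringKrullDim R = d)
include hdim

theorem ext_quotient_prime_subsingleton {Z : Type} [AddCommGroup Z] [Module R Z]
    [Module.Finite R Z] {e : ℕ}
    (hZ : ∀ j < e, Subsingleton (EE R (IsLocalRing.ResidueField R) Z j)) :
    ∀ (c : ℕ) (q : PrimeSpectrum R), chgt q = c → ∀ j, c + j < e →
      Subsingleton (EE R (R ⧸ q.asIdeal) Z j) := by
  intro c
  induction c using Nat.strong_induction_on with
  | _ c ih =>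
    intro q hq j hj
    by_cases hqm : q.asIdeal = IsLocalRing.maximalIdeal R
    · rw [hqm, ext_subsingleton_congr_left (residueFieldEquiv R)]
      exact hZ j (by lia)
    · obtain ⟨x, hxm, hxq⟩ : ∃ x ∈ IsLocalRing.maximalIdeal R, x ∉ q.asIdeal := by
        by_contra! h
        exact hqm (le_antisymm (IsLocalRing.le_maximalIdeal q.2.ne_top) h)
      refine (SES.pz_of_regular hxm (.of_notMem q hxq) j ?_).subsingleton
      have : Subsingleton (EE R (modX (R ⧸ q.asIdeal) x) Z (j + 1)) := by
        refine devissage (fun N _ _ => Subsingleton (EE R N Z (j + 1)))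
          (fun N _ _ _ => ext_subsingleton_left _)
          (fun _ _ _ _ _ _ _ _ _ f g h h1 h2 => h.ssL₂ Z _ h1 h2) _ ?_
        intro q' hq' Q _ _ e
        rw [ext_subsingleton_congr_left e]
        have := chgt_lt hdim (lt_of_annihilator_modX_le hxq hq')
        exact ih (chgt q') (by lia) q' rfl (j + 1) (by lia)
      exact .of_subsingleton

theorem ext_subsingleton_of_chgt {Z : Type} [AddCommGroup Z] [Module R Z]
    [Module.Finite R Z] {e : ℕ}
    (hZ : ∀ j < e, Subsingleton (EE R (IsLocalRing.ResidueField R) Z j))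
    (N : Type) [AddCommGroup N] [Module R N] [Module.Finite R N] (j : ℕ)
    (hN : ∀ q : PrimeSpectrum R, Module.annihilator R N ≤ q.asIdeal → chgt q + j < e) :
    Subsingleton (EE R N Z j) := by
  refine devissage (fun N _ _ => Subsingleton (EE R N Z j))
    (fun N _ _ _ => ext_subsingleton_left _)
    (fun _ _ _ _ _ _ _ _ _ f g h h1 h2 => h.ssL₂ Z _ h1 h2) _ ?_
  intro q hq Q _ _ e
  rw [ext_subsingleton_congr_left e]
  exact ext_quotient_prime_subsingleton hdim hZ _ q rfl j (hN q hq)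

end Ischebeck

section LocReg

variable {R : Type} [CommRing R]

/-- There is a sequence of length `t` in `p` which becomes regular on the localization of `N`
at `p`. -/
def LocReg (p : Ideal R) : ℕ → (N : Type) → [AddCommGroup N] → [Module R N] → Prop
  | 0, _, _, _ => True
  | t + 1, N, _, _ => ∃ x ∈ p, (∀ n : N, x • n = 0 → ∃ s ∉ p, s • n = 0) ∧ LocReg p t (modX N x)

lemma exists_regular_of_hom_residueField {A : Type} [CommRing A] [IsNoetherianRing A]
    [IsLocalRing A] {V : Type} [AddCommGroup V] [Module A V] [Module.Finite A V]
    (h : Subsingleton (EE A (IsLocalRing.ResidueField A) V 0)) :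
    ∃ r ∈ IsLocalRing.maximalIdeal A, ∀ v : V, r • v = 0 → v = 0 := by
  have h' : Subsingleton (IsLocalRing.ResidueField A →ₗ[A] V) :=
    (homEquivExt (IsLocalRing.ResidueField A) V).toEquiv.subsingleton
  obtain ⟨r, hr, hreg⟩ := IsSMulRegular.subsingleton_linearMap_iff.mp h'
  rw [← (residueFieldEquiv A).annihilator_eq, Ideal.annihilator_quotient] at hr
  exact ⟨r, hr, fun v hv => hreg.right_eq_zero_of_smul hv⟩

lemma locReg_of_ext [IsNoetherianRing R] {A : Type} [CommRing A] [IsNoetherianRing A]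
    [IsLocalRing A] [Algebra R A] (p : Ideal R) [hp : p.IsPrime] [IsLocalization.AtPrime A p] :
    ∀ (t : ℕ) (N : Type) [AddCommGroup N] [Module R N] [Module.Finite R N]
      (V : Type) [AddCommGroup V] [Module R V] [Module A V] [IsScalarTower R A V]
      (f : N →ₗ[R] V) [IsLocalizedModule p.primeCompl f],
      (∀ j < t, Subsingleton (EE A (IsLocalRing.ResidueField A) V j)) → LocReg p t N := by
  intro t
  induction t with
  | zero => intros; trivial
  | succ t ih =>
    intro N _ _ _ V _ _ _ _ f _ h
    have : Module.Finite A V := Module.Finite.of_isLocalizedModule p.primeCompl f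
    obtain ⟨r, hr, hreg⟩ := exists_regular_of_hom_residueField (h 0 (by lia))
    obtain ⟨x, s, rfl⟩ := IsLocalization.exists_mk'_eq p.primeCompl r
    have hx : x ∈ p := (IsLocalization.AtPrime.mk'_mem_maximal_iff A p x s).mp hr
    have hxreg : ∀ v : V, algebraMap R A x • v = 0 → v = 0 := by
      intro v hv
      refine hreg v ?_
      rw [IsLocalization.mk'_eq_mul_mk'_one, mul_comm, mul_smul, hv, smul_zero]
    refine ⟨x, hx, fun n hn => ?_, ?_⟩
    · have h1 : f n = 0 := hxreg _ (by rw [algebraMap_smul, ← map_smul, hn, map_zero])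
      obtain ⟨s, hs⟩ := (IsLocalizedModule.eq_zero_iff p.primeCompl f).mp h1
      exact ⟨s, s.2, hs⟩
    · let L : Submodule A V :=
        (LinearMap.range (LinearMap.lsmul R N x)).localized' A p.primeCompl f
      have hL : L = LinearMap.range (LinearMap.lsmul A V (algebraMap R A x)) := by
        ext v
        simp only [L, Submodule.mem_localized', LinearMap.mem_range]
        constructor
        · rintro ⟨_, ⟨n, rfl⟩, s, rfl⟩
          refine ⟨IsLocalizedModule.mk' f n s, ?_⟩
          simp [IsLocalizedModule.mk'_smul]
        · rintro ⟨v, rfl⟩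
          obtain ⟨⟨n, s⟩, rfl⟩ := IsLocalizedModule.mk'_surjective p.primeCompl f v
          refine ⟨x • n, ⟨n, rfl⟩, s, ?_⟩
          simp [IsLocalizedModule.mk'_smul]
      have hS : SES (LinearMap.lsmul A V (algebraMap R A x)) L.mkQ := by
        rw [hL]; exact .of_regular hxreg
      refine ih (modX N x) (V ⧸ L)
        ((LinearMap.range (LinearMap.lsmul R N x)).toLocalizedQuotient' A p.primeCompl f) ?_
      intro j hj
      exact hS.ssR₃ _ j (h j (by lia)) (h (j + 1) (by lia))

lemma ext_subsingleton_of_lt_rdepth {A : Type} [CommRing A] [IsLocalRing A] {V : Type}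
    [AddCommGroup V] [Module A V] {j : ℕ} (h : (j : ℕ∞) < rdepth A V) :
    Subsingleton (EE A (IsLocalRing.ResidueField A) V j) := by
  rw [← subsingleton_ext1_iff]
  by_contra hj
  exact (h.trans_le (sInf_le ⟨j, rfl, hj⟩)).false

lemma IsMCM.ext_subsingleton {A : Type} [CommRing A] [IsLocalRing A] {V : Type}
    [AddCommGroup V] [Module A V] {d : ℕ} (h : IsMCM A d V) :
    ∀ j < d, Subsingleton (EE A (IsLocalRing.ResidueField A) V j) := fun j hj =>
  ext_subsingleton_of_lt_rdepth (lt_of_lt_of_le (by exact_mod_cast hj) h.2)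

lemma locReg_maximalIdeal [IsNoetherianRing R] [IsLocalRing R] {N : Type} [AddCommGroup N]
    [Module R N] [Module.Finite R N] {t : ℕ}
    (h : ∀ j < t, Subsingleton (EE R (IsLocalRing.ResidueField R) N j)) :
    LocReg (IsLocalRing.maximalIdeal R) t N := by
  have hu : (IsLocalRing.maximalIdeal R).primeCompl ≤ IsUnit.submonoid R := by
    intro x hx
    simpa [IsUnit.mem_submonoid_iff] using hx
  have : IsLocalization.AtPrime R (IsLocalRing.maximalIdeal R) := IsLocalization.self hu
  have := isLocalizedModule_id (IsLocalRing.maximalIdeal R).primeCompl N R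
  exact locReg_of_ext (A := R) _ t N N .id h

lemma SerreS.locReg [IsNoetherianRing R] {N : Type} [AddCommGroup N]
    [Module R N] [Module.Finite R N] {n d : ℕ} (hdim : ringKrullDim R = d) (h : SerreS R n N)
    (p : PrimeSpectrum R) {t : ℕ} (h1 : t ≤ n) (h2 : t ≤ hgt p) : LocReg p.asIdeal t N := by
  refine locReg_of_ext (A := Localization.AtPrime p.asIdeal) p.asIdeal t N
    (LocalizedModule p.asIdeal.primeCompl N) (LocalizedModule.mkLinearMap _ _) fun j hj => ?_
  refine ext_subsingleton_of_lt_rdepth ?_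
  have := h p
  rw [ringKrullDim_atPrime hdim] at this
  have h4 : ((min n (hgt p) : ℕ) : ℕ∞) ≤ rdepth (Localization.AtPrime p.asIdeal)
      (LocalizedModule p.asIdeal.primeCompl N) := by
    rw [← WithBot.coe_le_coe]
    refine le_trans (le_of_eq ?_) this
    push_cast
    rfl
  refine lt_of_lt_of_le ?_ h4
  have : j < min n (hgt p) := by lia
  exact_mod_cast this

end LocReg

section

variable {A : Type} [CommRing A]

lemma PZ.ext_left {p : Ideal A} [p.IsPrime] {K W : Type} [AddCommGroup K] [Module A K]
    [Module.Finite A K] [AddCommGroup W] [Module A W] (h : PZ p K) (j : ℕ) :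
    PZ p (EE A K W j) := by
  obtain ⟨s, hs, hK⟩ := h.exists_smul
  refine .of_smul s hs fun e => ?_
  rw [← extL_lsmul, show LinearMap.lsmul A K s = 0 from LinearMap.ext hK, extL_zero]

theorem LocReg.pz_ext [IsNoetherianRing A] {p : Ideal A} [p.IsPrime] {W : Type} [AddCommGroup W]
    [Module A W] [Module.Finite A W] {b : ℕ}
    (hB : ∀ (N : Type) [AddCommGroup N] [Module A N] [Module.Finite A N], ∀ j > b,
      PZ p (EE A N W j)) :
    ∀ (t : ℕ) (N : Type) [AddCommGroup N] [Module A N] [Module.Finite A N],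
      LocReg p t N → ∀ j, j + t > b → PZ p (EE A N W j) := by
  intro t
  induction t with
  | zero => exact fun N _ _ _ _ j hj => hB N j hj
  | succ t ih =>
    intro N _ _ _ h j hj
    obtain ⟨x, hx, hreg, h'⟩ := h
    have h1 : PZ p (EE A (modX N x) W (j + 1)) := ih (modX N x) h' (j + 1) (by lia)
    let m := LinearMap.lsmul A N x
    have hK : PZ p (EE A (LinearMap.ker m) W j) := by
      refine PZ.ext_left (fun n => ?_) j
      obtain ⟨s, hs, hn⟩ := hreg n n.2
      exact ⟨s, hs, Subtype.ext hn⟩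
    have S1 : SES (LinearMap.ker m.rangeRestrict).subtype m.rangeRestrict :=
      .of_surjective m.surjective_rangeRestrict
    have S2 := SES.of_submodule (LinearMap.range m)
    refine PZ.nakayama hx fun e => ?_
    have hK' : PZ p (EE A (LinearMap.ker m.rangeRestrict) W j) := by
      rwa [LinearMap.ker_rangeRestrict]
    obtain ⟨s, hs, hse⟩ := hK' (extL W _ j e)
    rw [← map_smul, S1.exactL₂ W j] at hse
    obtain ⟨e₁, he₁⟩ := hse
    obtain ⟨s', hs', hse'⟩ := h1 (S2.deltaL W j e₁)
    rw [← map_smul, S2.exactL₁ W j] at hse'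
    obtain ⟨e₂, he₂⟩ := hse'
    refine ⟨s' * s, fun h => (Ideal.IsPrime.mem_or_mem ‹_› h).elim hs' hs, e₂, ?_⟩
    rw [mul_smul, ← he₁, ← map_smul, ← he₂, extL_extL, ← extL_lsmul]
    rfl

end

section QuotientSequence

variable {A : Type} [CommRing A] {V : Type} [AddCommGroup V] [Module A V]

lemma SES.factor {K L : Submodule A V} {x : A} (hKL : K ≤ L)
    (hL : ∀ v : V, v ∈ L ↔ ∃ a ∈ K, ∃ n, v = a + x • n) (hreg : ∀ v : V, x • v ∈ K → v ∈ K) :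
    SES (LinearMap.lsmul A (V ⧸ K) x) (Submodule.factor hKL) where
  inj := by
    rw [injective_iff_map_eq_zero]
    intro v hv
    obtain ⟨v, rfl⟩ := Submodule.mkQ_surjective _ v
    rw [LinearMap.lsmul_apply, ← map_smul] at hv
    rw [Submodule.mkQ_apply, Submodule.Quotient.mk_eq_zero] at hv ⊢
    exact hreg v hv
  exact := by
    intro v
    obtain ⟨v, rfl⟩ := Submodule.mkQ_surjective _ v
    rw [Submodule.mkQ_apply, show Submodule.factor hKL (Submodule.Quotient.mk v) =
      Submodule.Quotient.mk v from rfl, Submodule.Quotient.mk_eq_zero, hL]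
    constructor
    · rintro ⟨a, ha, n, rfl⟩
      refine ⟨Submodule.Quotient.mk n, ?_⟩
      rw [LinearMap.lsmul_apply, ← Submodule.Quotient.mk_smul, eq_comm, Submodule.Quotient.eq]
      simpa using ha
    · rintro ⟨n, hn⟩
      obtain ⟨n, rfl⟩ := Submodule.mkQ_surjective _ n
      rw [LinearMap.lsmul_apply, ← map_smul, eq_comm, Submodule.mkQ_apply,
        Submodule.Quotient.eq] at hn
      exact ⟨_, hn, n, by abel⟩
  surj := Submodule.factor_surjective hKL

end QuotientSequence

section Bass

variable {R : Type} [CommRing R] [IsNoetherianRing R]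
  {d : ℕ}

omit [IsNoetherianRing R] in
lemma mem_sup_span_singleton_iff (I : Ideal R) (x v : R) :
    v ∈ I ⊔ Ideal.span {x} ↔ ∃ a ∈ I, ∃ n, v = a + x • n := by
  rw [Submodule.mem_sup]
  constructor
  · rintro ⟨a, ha, b, hb, rfl⟩
    obtain ⟨n, rfl⟩ := Ideal.mem_span_singleton'.mp hb
    exact ⟨a, ha, n, by rw [smul_eq_mul, mul_comm]⟩
  · rintro ⟨a, ha, n, rfl⟩
    exact ⟨a, ha, x * n, Ideal.mul_mem_right _ _ (Ideal.mem_span_singleton_self x), rfl⟩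

omit [IsNoetherianRing R] in
lemma SES.idealQuotient {I : Ideal R} {x : R} (hreg : ∀ v : R, x * v ∈ I → v ∈ I) :
    SES (LinearMap.lsmul R (R ⧸ I) x)
      (Submodule.factor (le_sup_left : I ≤ I ⊔ Ideal.span {x})) :=
  .factor _ (mem_sup_span_singleton_iff I x) hreg

lemma hgt_sup_span_singleton (hdim : ringKrullDim R = d) {I : Ideal R} {x : R}
    (hreg : ∀ v : R, x * v ∈ I → v ∈ I) {r : ℕ}
    (h : ∀ q : PrimeSpectrum R, I ≤ q.asIdeal → r ≤ hgt q) (q : PrimeSpectrum R)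
    (hq : I ⊔ Ideal.span {x} ≤ q.asIdeal) : r + 1 ≤ hgt q := by
  obtain ⟨q₀, hq₀, hle⟩ := Ideal.exists_minimalPrimes_le (le_sup_left.trans hq)
  have hann : Module.annihilator R (R ⧸ I) = I := Ideal.annihilator_quotient
  have hass : q₀ ∈ associatedPrimes R (R ⧸ I) :=
    Module.associatedPrimes.minimalPrimes_annihilator_subset_associatedPrimes R (R ⧸ I)
      (by rwa [hann])
  have hxq₀ : x ∉ q₀ := by
    intro hx
    have : x ∈ ⋃ p ∈ associatedPrimes R (R ⧸ I), (p : Set R) := Set.mem_biUnion hass hx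
    rw [biUnion_associatedPrimes_eq_compl_regular] at this
    refine this ((isSMulRegular_iff_right_eq_zero_of_smul).mpr ?_)
    intro v hv
    obtain ⟨v, rfl⟩ := Ideal.Quotient.mk_surjective v
    change Ideal.Quotient.mk _ (x * v) = 0 at hv
    rw [Ideal.Quotient.eq_zero_iff_mem] at hv ⊢
    exact hreg v hv
  have : q₀.IsPrime := hq₀.1.1
  have hlt : (⟨q₀, this⟩ : PrimeSpectrum R) < q := by
    refine lt_of_le_of_ne hle ?_
    rintro rfl
    exact hxq₀ (hq (Submodule.mem_sup_right (Ideal.mem_span_singleton_self x)))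
  have h1 := hgt_lt hdim hlt
  have h2 := h ⟨q₀, this⟩ hq₀.1.2
  lia

variable [IsLocalRing R]

/-- `I` behaves like an ideal generated by a regular sequence of length `r`. -/
structure RegLike (d r : ℕ) (I : Ideal R) : Prop where
  hgt_le : ∀ q : PrimeSpectrum R, I ≤ q.asIdeal → r ≤ hgt q
  pd : ∀ (V : Type) [AddCommGroup V] [Module R V], ∀ j > r, Subsingleton (EE R (R ⧸ I) V j)
  depth : ∀ j, j + r < d → Subsingleton (EE R (IsLocalRing.ResidueField R) (R ⧸ I) j)

omit [IsNoetherianRing R] in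
lemma RegLike.bot (hCM : ∀ j < d, Subsingleton (EE R (IsLocalRing.ResidueField R) R j)) :
    RegLike d 0 (⊥ : Ideal R) where
  hgt_le _ _ := Nat.zero_le _
  pd V _ _ j hj := by
    obtain ⟨j, rfl⟩ := Nat.exists_eq_add_of_lt hj
    rw [ext_subsingleton_congr_left (Submodule.quotEquivOfEqBot (⊥ : Ideal R) rfl)]
    simpa using ext_subsingleton_of_projective j
  depth j hj := by
    rw [ext_subsingleton_congr_right (Submodule.quotEquivOfEqBot (⊥ : Ideal R) rfl)]
    exact hCM j (by simpa using hj)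

lemma RegLike.step (hdim : ringKrullDim R = d) {r : ℕ} {I : Ideal R} (h : RegLike d r I) {x : R}
    (hreg : ∀ v : R, x * v ∈ I → v ∈ I) : RegLike d (r + 1) (I ⊔ Ideal.span {x}) where
  hgt_le := hgt_sup_span_singleton hdim hreg h.hgt_le
  pd V _ _ j hj := by
    obtain ⟨j, rfl⟩ : ∃ i, j = i + 1 := ⟨j - 1, by lia⟩
    exact (SES.idealQuotient hreg).ssL₃ V j (h.pd V j (by lia)) (h.pd V (j + 1) (by lia))
  depth j hj := (SES.idealQuotient hreg).ssR₃ _ j (h.depth j (by lia)) (h.depth (j + 1) (by lia))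

lemma exists_regLike (hdim : ringKrullDim R = d)
    (hCM : ∀ j < d, Subsingleton (EE R (IsLocalRing.ResidueField R) R j)) (p : PrimeSpectrum R) :
    ∃ I : Ideal R, I ≤ p.asIdeal ∧ RegLike d (hgt p) I ∧
      ∃ f : (R ⧸ p.asIdeal) →ₗ[R] (R ⧸ I), Function.Injective f := by
  obtain ⟨r, I, hIp, hI, hmax⟩ : ∃ (r : ℕ) (I : Ideal R), I ≤ p.asIdeal ∧ RegLike d r I ∧
      ∀ x ∈ p.asIdeal, ¬ ∀ v : R, x * v ∈ I → v ∈ I := by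
    by_contra! hcon
    have : ∀ r : ℕ, ∃ I : Ideal R, I ≤ p.asIdeal ∧ RegLike d r I := by
      intro r
      induction r with
      | zero => exact ⟨⊥, bot_le, .bot hCM⟩
      | succ r ih =>
        obtain ⟨I, hI, hr⟩ := ih
        obtain ⟨x, hx, hreg⟩ := hcon r I hI hr
        exact ⟨_, sup_le hI ((Ideal.span_singleton_le_iff_mem _).mpr hx), hr.step hdim hreg⟩
    obtain ⟨I, hI, hr⟩ := this (hgt p + 1)
    have := hr.hgt_le p hI
    lia
  have hrp := hI.hgt_le p hIp
  have hF2 : ∀ (N : Type) [AddCommGroup N] [Module R N] [Module.Finite R N],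
      (∀ q : PrimeSpectrum R, Module.annihilator R N ≤ q.asIdeal → r < hgt q) →
      Subsingleton (N →ₗ[R] R ⧸ I) := by
    intro N _ _ _ hN
    refine (homEquivExt N (R ⧸ I)).toEquiv.subsingleton_congr.mpr ?_
    refine ext_subsingleton_of_chgt hdim (e := d - r) (fun j hj => hI.depth j (by lia)) N 0 ?_
    intro q hq
    have := hN q hq
    have := hgt_add_chgt_le hdim q
    lia
  have hnon : ¬ Subsingleton ((R ⧸ p.asIdeal) →ₗ[R] R ⧸ I) := by
    rw [IsSMulRegular.subsingleton_linearMap_iff, Ideal.annihilator_quotient]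
    rintro ⟨x, hx, hreg⟩
    refine hmax x hx fun v hv => ?_
    rw [← Ideal.Quotient.eq_zero_iff_mem]
    refine hreg.right_eq_zero_of_smul ?_
    exact Ideal.Quotient.eq_zero_iff_mem.mpr hv
  have hr : r = hgt p := by
    by_contra hne
    refine hnon (hF2 _ fun q hq => ?_)
    rw [Ideal.annihilator_quotient] at hq
    have := hgt_mono hdim (show p ≤ q from hq)
    lia
  subst hr
  refine ⟨I, hIp, hI, ?_⟩
  rw [not_subsingleton_iff_nontrivial] at hnon
  obtain ⟨f, hf⟩ := exists_ne (0 : (R ⧸ p.asIdeal) →ₗ[R] R ⧸ I)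
  refine ⟨f, ?_⟩
  by_contra hinj
  rw [injective_iff_map_eq_zero] at hinj
  push Not at hinj
  obtain ⟨a, ha, ha0⟩ := hinj
  obtain ⟨a, rfl⟩ := Ideal.Quotient.mk_surjective a
  have hap : a ∉ p.asIdeal := fun h => ha0 (Ideal.Quotient.eq_zero_iff_mem.mpr h)
  have hker : LinearMap.ker f ≠ ⊤ := fun h => hf (LinearMap.ker_eq_top.mp h)
  have hs := hF2 ((R ⧸ p.asIdeal) ⧸ LinearMap.ker f) fun q hq => ?_
  · refine hf (LinearMap.ext fun v => ?_)
    have h1 : (LinearMap.ker f).liftQ f le_rfl = 0 := Subsingleton.elim _ _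
    have := LinearMap.congr_fun h1 (Submodule.Quotient.mk v)
    simpa using this
  · refine hgt_lt hdim (lt_of_le_of_ne ?_ ?_)
    · change p.asIdeal ≤ q.asIdeal
      refine le_trans ?_ hq
      have := (LinearMap.ker f).mkQ.annihilator_le_of_surjective (Submodule.mkQ_surjective _)
      rwa [Ideal.annihilator_quotient] at this
    · rintro rfl
      refine hap (hq ?_)
      rw [Module.mem_annihilator]
      intro v
      obtain ⟨v, rfl⟩ := Submodule.mkQ_surjective _ v
      obtain ⟨v, rfl⟩ := Ideal.Quotient.mk_surjective v
      rw [← map_smul, Submodule.mkQ_apply, Submodule.Quotient.mk_eq_zero, LinearMap.mem_ker]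
      have : a • (Ideal.Quotient.mk p.asIdeal v) = v • Ideal.Quotient.mk p.asIdeal a := by
        change Ideal.Quotient.mk _ (a * v) = Ideal.Quotient.mk _ (v * a)
        rw [mul_comm]
      rw [this, map_smul, ha, smul_zero]

/-- Finite injective dimension, in terms of `EE`. -/
def FID (A : Type) [CommRing A] (W : Type) [AddCommGroup W] [Module A W] : Prop :=
  ∃ n : ℕ, ∀ (N : Type) [AddCommGroup N] [Module A N], ∀ j > n, Subsingleton (EE A N W j)

omit [IsNoetherianRing R] [IsLocalRing R] in
lemma HasFID.fid {W : Type} [AddCommGroup W] [Module R W] (h : HasFID R W) : FID R W := by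
  obtain ⟨n, hn⟩ := h
  exact ⟨n, fun N _ _ j hj => (subsingleton_ext1_iff R j N W).mp (hn N j hj)⟩

omit [IsNoetherianRing R] [IsLocalRing R] in
lemma pz_quotient_of_not_le {p q : PrimeSpectrum R} (h : ¬ q ≤ p) (W : Type) [AddCommGroup W]
    [Module R W] (j : ℕ) : PZ p.asIdeal (EE R (R ⧸ q.asIdeal) W j) := by
  obtain ⟨s, hs, hsp⟩ := SetLike.not_le_iff_exists.mp (show ¬ q.asIdeal ≤ p.asIdeal from h)
  refine PZ.ext_left (.of_smul s hsp fun v => ?_) j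
  obtain ⟨v, rfl⟩ := Ideal.Quotient.mk_surjective v
  exact Ideal.Quotient.eq_zero_iff_mem.mpr (q.asIdeal.mul_mem_right v hs)

theorem FID.pz_ext (hdim : ringKrullDim R = d)
    (hCM : ∀ j < d, Subsingleton (EE R (IsLocalRing.ResidueField R) R j)) {W : Type}
    [AddCommGroup W] [Module R W] [Module.Finite R W] (hW : FID R W) (p : PrimeSpectrum R)
    (N : Type) [AddCommGroup N] [Module R N] [Module.Finite R N] (j : ℕ) (hj : hgt p < j) :
    PZ p.asIdeal (EE R N W j) := by
  have hdev : ∀ (j : ℕ) (N : Type) [AddCommGroup N] [Module R N] [Module.Finite R N],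
      (∀ q : PrimeSpectrum R, Module.annihilator R N ≤ q.asIdeal →
        PZ p.asIdeal (EE R (R ⧸ q.asIdeal) W j)) → PZ p.asIdeal (EE R N W j) := by
    intro j N _ _ _ hN
    refine devissage (fun N _ _ => PZ p.asIdeal (EE R N W j))
      (fun N _ _ _ => have : Subsingleton (EE R N W j) := ext_subsingleton_left j; .of_subsingleton)
      (fun _ _ _ _ _ _ _ _ _ f g h h1 h2 => h.pzL₂ W _ h1 h2) _ ?_
    exact fun q hq Q _ _ e => pz_congr_left e (hN q hq)
  have hp : ∀ j, hgt p < j → PZ p.asIdeal (EE R (R ⧸ p.asIdeal) W j) := by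
    obtain ⟨n, hn⟩ := hW
    obtain ⟨I, hIp, hI, f, hf⟩ := exists_regLike hdim hCM p
    suffices ∀ k j, n < j + k → hgt p < j → PZ p.asIdeal (EE R (R ⧸ p.asIdeal) W j) from
      fun j hj => this (n + 1) j (by lia) hj
    intro k
    induction k with
    | zero =>
      intro j hj _
      have := hn (R ⧸ p.asIdeal) j hj
      exact .of_subsingleton
    | succ k ih =>
      intro j hj hj'
      have := hI.pd W j hj'
      refine (SES.of_injective hf).pzL₁ W j .of_subsingleton (hdev _ _ fun q hq => ?_)
      have hIq : I ≤ q.asIdeal := by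
        refine le_trans ?_ hq
        have := (LinearMap.range f).mkQ.annihilator_le_of_surjective (Submodule.mkQ_surjective _)
        rwa [Ideal.annihilator_quotient] at this
      by_cases hqp : q ≤ p
      · rcases hqp.eq_or_lt with rfl | hlt
        · exact ih (j + 1) (by lia) (by lia)
        · have := hgt_lt hdim hlt
          have := hI.hgt_le q hIq
          lia
      · exact pz_quotient_of_not_le hqp W _
  have hq : ∀ (c : ℕ) (q : PrimeSpectrum R), chgt q = c → ∀ j, hgt p < j →
      PZ p.asIdeal (EE R (R ⧸ q.asIdeal) W j) := by
    intro c
    induction c using Nat.strong_induction_on with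
    | _ c ih =>
      intro q hc j hj
      by_cases hqp : q ≤ p
      · rcases hqp.eq_or_lt with rfl | hlt
        · exact hp j hj
        · obtain ⟨x, hxp, hxq⟩ := SetLike.not_le_iff_exists.mp
            (show ¬ p.asIdeal ≤ q.asIdeal from hlt.not_ge)
          refine SES.pz_of_regular hxp (.of_notMem q hxq) j (hdev _ _ fun q' hq' => ?_)
          have := chgt_lt hdim (lt_of_annihilator_modX_le hxq hq')
          exact ih (chgt q') (by lia) q' rfl (j + 1) (by lia)
      · exact pz_quotient_of_not_le hqp W _
  exact hdev j N fun q _ => hq _ q rfl j hj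

end Bass

section Canonical

variable {R : Type} [CommRing R] [IsNoetherianRing R] [IsLocalRing R] {d : ℕ}
  {ω : Type} [AddCommGroup ω] [Module R ω]

/-- A Cohen-Macaulay local ring with a canonical module, with all conditions in terms of
Yoneda extensions. -/
structure Canon (R : Type) [CommRing R] [IsLocalRing R] (d : ℕ) (ω : Type) [AddCommGroup ω]
    [Module R ω] : Prop where
  dim : ringKrullDim R = d
  depth_ring : ∀ j < d, Subsingleton (EE R (ResidueField R) R j)
  finite : Module.Finite R ω
  depth : ∀ j < d, Subsingleton (EE R (ResidueField R) ω j)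
  fid : FID R ω
  type_one : Nonempty (EE R (ResidueField R) ω d ≃ₗ[R] ResidueField R)

omit [IsNoetherianRing R] in
lemma IsCanonicalModule.canon (hdim : ringKrullDim R = d) (hCM : (d : ℕ∞) ≤ rdepth R R)
    (h : IsCanonicalModule R d ω) : Canon R d ω where
  dim := hdim
  depth_ring := fun _ hj => ext_subsingleton_of_lt_rdepth
    (lt_of_lt_of_le (by exact_mod_cast hj) hCM)
  finite := h.1.1
  depth := h.1.ext_subsingleton
  fid := h.2.1.fid
  type_one := h.2.2.map fun e => (extEquiv R d _ ω).symm.trans e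

theorem FID.ext_subsingleton (hdim : ringKrullDim R = d)
    (hCM : ∀ j < d, Subsingleton (EE R (ResidueField R) R j)) {W : Type}
    [AddCommGroup W] [Module R W] [Module.Finite R W] (hW : FID R W)
    {V : Type} [AddCommGroup V] [Module R V] [Module.Finite R V] {t : ℕ}
    (hV : ∀ j < t, Subsingleton (EE R (ResidueField R) V j)) (j : ℕ) (hj : d < j + t) :
    Subsingleton (EE R V W j) := by
  have hB : ∀ (N : Type) [AddCommGroup N] [Module R N] [Module.Finite R N], ∀ j > d,
      PZ (maximalIdeal R) (EE R N W j) := by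
    intro N _ _ _ j hj
    refine hW.pz_ext hdim hCM (closedPoint R) N j ?_
    rwa [hgt_closedPoint hdim]
  exact (LocReg.pz_ext hB t V (locReg_maximalIdeal hV) j hj).subsingleton

omit [IsNoetherianRing R] in
lemma le_of_forall_exists_add_smul {V : Type} [AddCommGroup V] [Module R V] {N N' : Submodule R V}
    (hN' : N'.FG) {x : R} (hx : x ∈ maximalIdeal R)
    (h : ∀ n ∈ N', ∃ a ∈ N, ∃ b ∈ N', n = a + x • b) : N' ≤ N := by
  refine Submodule.le_of_le_smul_of_le_jacobson_bot hN'
    (IsLocalRing.jacobson_eq_maximalIdeal ⊥ bot_ne_top).ge fun n hn => ?_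
  obtain ⟨a, ha, b, hb, rfl⟩ := h n hn
  exact Submodule.add_mem_sup ha (Submodule.smul_mem_smul hx hb)

variable (R ω) in
/-- The conditions on an ideal `I` which behaves like an ideal generated by a regular sequence of
length `r` on both `R` and `ω`. -/
structure RegCanon (d r : ℕ) (I : Ideal R) : Prop extends RegLike d r I where
  depth_canon : ∀ j, j + r < d →
    Subsingleton (EE R (ResidueField R) (ω ⧸ (I • ⊤ : Submodule R ω)) j)
  type_one : Nonempty (EE R (ResidueField R) (ω ⧸ (I • ⊤ : Submodule R ω)) (d - r)
    ≃ₗ[R] ResidueField R)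
  surj : ∀ (N' N : Type) [AddCommGroup N'] [Module R N'] [Module.Finite R N'] [AddCommGroup N]
    [Module R N] [Module.Finite R N] (i : N' →ₗ[R] N), Function.Injective i →
    I ≤ Module.annihilator R N →
    (∀ q : PrimeSpectrum R, Module.annihilator R N ≤ q.asIdeal → chgt q = 0) →
    Function.Surjective (extL (ω ⧸ (I • ⊤ : Submodule R ω)) i (d - r))

variable (R ω) in
/-- Every map `ω → ω/Iω` is a multiple of the projection by a unique element of `R/I`. -/
structure Centralizer (I : Ideal R) : Prop where
  mem : ∀ a : R, (∀ w : ω, a • w ∈ (I • ⊤ : Submodule R ω)) → a ∈ I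
  exists_smul : ∀ φ : ω →ₗ[R] ω ⧸ (I • ⊤ : Submodule R ω), ∃ a : R,
    φ = a • (I • ⊤ : Submodule R ω).mkQ

omit [IsNoetherianRing R] [IsLocalRing R] in
lemma mem_sup_smul_top_iff (I : Ideal R) (x : R) (v : ω) :
    v ∈ ((I ⊔ Ideal.span {x}) • ⊤ : Submodule R ω) ↔
      ∃ a ∈ (I • ⊤ : Submodule R ω), ∃ n, v = a + x • n := by
  rw [Submodule.sup_smul, Submodule.mem_sup]
  constructor
  · rintro ⟨a, ha, b, hb, rfl⟩
    rw [Submodule.ideal_span_singleton_smul, Submodule.mem_smul_pointwise_iff_exists] at hb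
    obtain ⟨n, -, rfl⟩ := hb
    exact ⟨a, ha, n, rfl⟩
  · rintro ⟨a, ha, n, rfl⟩
    exact ⟨a, ha, x • n, Submodule.smul_mem_smul (Ideal.mem_span_singleton_self x) trivial, rfl⟩

omit [IsNoetherianRing R] [IsLocalRing R] in
lemma SES.canonQuotient {I : Ideal R} {x : R}
    (hreg : ∀ v : ω, x • v ∈ (I • ⊤ : Submodule R ω) → v ∈ (I • ⊤ : Submodule R ω)) :
    SES (LinearMap.lsmul R (ω ⧸ (I • ⊤ : Submodule R ω)) x)
      (Submodule.factor (Submodule.smul_mono_left (le_sup_left : I ≤ I ⊔ Ideal.span {x}))) :=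
  .factor _ (mem_sup_smul_top_iff I x) hreg

lemma Canon.regCanon_bot (h : Canon R d ω) : RegCanon R ω d 0 (⊥ : Ideal R) where
  toRegLike := .bot h.depth_ring
  depth_canon j hj := by
    rw [ext_subsingleton_congr_right
      (Submodule.quotEquivOfEqBot ((⊥ : Ideal R) • ⊤ : Submodule R ω) (by simp))]
    exact h.depth j (by simpa using hj)
  type_one := by
    obtain ⟨e⟩ := h.type_one
    exact ⟨(extREquiv _ (Submodule.quotEquivOfEqBot
      ((⊥ : Ideal R) • ⊤ : Submodule R ω) (by simp)) d).trans e⟩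
  surj N' N _ _ _ _ _ _ i hi _ _ := by
    intro e
    have := h.finite
    have hs : Subsingleton (EE R (N ⧸ LinearMap.range i)
        (ω ⧸ ((⊥ : Ideal R) • ⊤ : Submodule R ω)) (d - 0 + 1)) := by
      rw [ext_subsingleton_congr_right
        (Submodule.quotEquivOfEqBot ((⊥ : Ideal R) • ⊤ : Submodule R ω) (by simp))]
      exact h.fid.ext_subsingleton h.dim h.depth_ring (t := 0) (by simp) _ (by lia)
    exact ((SES.of_injective hi).exactL₁ _ _ e).mp (Subsingleton.elim _ _)

lemma RegCanon.step [Module.Finite R ω] (hdim : ringKrullDim R = d) {r : ℕ} {I : Ideal R}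
    (h : RegCanon R ω d r I) (hr : r < d) {x : R} (hx : x ∈ maximalIdeal R)
    (hreg : ∀ v : R, x * v ∈ I → v ∈ I)
    (hregω : ∀ v : ω, x • v ∈ (I • ⊤ : Submodule R ω) → v ∈ (I • ⊤ : Submodule R ω)) :
    RegCanon R ω d (r + 1) (I ⊔ Ideal.span {x}) := by
  obtain ⟨c, hc⟩ : ∃ c, d - r = c + 1 := ⟨d - r - 1, by lia⟩
  have hc' : d - (r + 1) = c := by lia
  have S := SES.canonQuotient hregω
  refine { toRegLike := h.toRegLike.step hdim hreg, depth_canon := ?_, type_one := ?_, surj := ?_ }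
  · exact fun j hj => S.ssR₃ _ j (h.depth_canon j (by lia)) (h.depth_canon (j + 1) (by lia))
  · obtain ⟨e⟩ := h.type_one
    rw [hc] at e
    rw [hc']
    have h0 := h.depth_canon c (by lia)
    refine ⟨(LinearEquiv.ofBijective (S.deltaR (ResidueField R) c) ⟨?_, ?_⟩).trans e⟩
    · rw [injective_iff_map_eq_zero]
      intro y hy
      obtain ⟨y, rfl⟩ := (S.exactR₃ _ c y).mp hy
      rw [Subsingleton.elim y 0, map_zero]
    · intro y
      refine (S.exactR₁ _ c y).mp ?_
      rw [extR_lsmul]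
      apply e.injective
      rw [map_smul, map_zero]
      obtain ⟨z, hz⟩ := IsLocalRing.residue_surjective (e y)
      rw [← hz, Algebra.smul_def]
      change residue R x * _ = 0
      rw [(residue_eq_zero_iff x).mpr hx, zero_mul]
  · intro N' N _ _ _ _ _ _ i hi hI hq
    rw [hc']
    intro e'
    have hsurj := h.surj N' N i hi (le_sup_left.trans hI) hq
    rw [hc] at hsurj
    obtain ⟨e, he⟩ := hsurj (S.deltaR N' c e')
    have hxe : extR N (LinearMap.lsmul R (ω ⧸ (I • ⊤ : Submodule R ω)) x) (c + 1) e = 0 := by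
      rw [extR_lsmul, ← extL_lsmul, show LinearMap.lsmul R N x = 0 from LinearMap.ext fun n =>
        Module.mem_annihilator.mp
          (hI (Submodule.mem_sup_right (Ideal.mem_span_singleton_self x))) n,
        extL_zero]
    obtain ⟨e'', rfl⟩ := (S.exactR₁ _ c e).mp hxe
    rw [← S.deltaR_extL, ← sub_eq_zero, ← map_sub] at he
    obtain ⟨y, hy⟩ := (S.exactR₃ _ c _).mp he
    have hs : Subsingleton (EE R N' (ω ⧸ (I • ⊤ : Submodule R ω)) c) := by
      refine ext_subsingleton_of_chgt hdim (e := c + 1)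
        (fun j hj => h.depth_canon j (by lia)) N' c fun q hqN => ?_
      rw [hq q ((i.annihilator_le_of_injective hi).trans hqN)]
      lia
    rw [Subsingleton.elim y 0, map_zero, eq_comm, sub_eq_zero] at hy
    exact ⟨e'', hy⟩

omit [IsNoetherianRing R] in
lemma length_residueField : Module.length R (ResidueField R) = 1 := by
  rw [Module.length_eq_one_iff, ← (residueFieldEquiv R).isSimpleModule_iff,
    isSimpleModule_iff_isCoatom]
  exact (IsLocalRing.maximalIdeal.isMaximal R).out

omit [IsNoetherianRing R] in
lemma RegLike.chgt_eq_zero {I : Ideal R} (hdim : ringKrullDim R = d) (h : RegLike d d I)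
    {q : PrimeSpectrum R} (hq : I ≤ q.asIdeal) : chgt q = 0 := by
  have := h.hgt_le q hq
  have := hgt_add_chgt_le hdim q
  lia

omit [IsNoetherianRing R] in
lemma RegCanon.length_quotient_prime {I : Ideal R} (hdim : ringKrullDim R = d)
    (h : RegCanon R ω d d I) {q : PrimeSpectrum R} (hq : I ≤ q.asIdeal) :
    Module.length R (EE R (R ⧸ q.asIdeal) (ω ⧸ (I • ⊤ : Submodule R ω)) 0) = 1 ∧
      Module.length R (R ⧸ q.asIdeal) = 1 := by
  have hqm : q.asIdeal = maximalIdeal R := by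
    by_contra hne
    have : q < closedPoint R :=
      lt_of_le_of_ne (IsLocalRing.le_maximalIdeal q.2.ne_top) fun h => hne (by rw [h]; rfl)
    have := chgt_lt hdim this
    rw [h.chgt_eq_zero hdim hq] at this
    lia
  obtain ⟨e⟩ := h.type_one
  rw [Nat.sub_self] at e
  rw [hqm, (residueFieldEquiv R).length_eq, length_residueField,
    (extLEquiv (ω ⧸ (I • ⊤ : Submodule R ω)) (residueFieldEquiv R) 0).symm.length_eq,
    e.length_eq, length_residueField]
  simp

lemma RegCanon.length_hom {I : Ideal R} (hdim : ringKrullDim R = d) (h : RegCanon R ω d d I)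
    (N : Type) [AddCommGroup N] [Module R N] [hf : Module.Finite R N]
    (hN : I ≤ Module.annihilator R N) :
    Module.length R (EE R N (ω ⧸ (I • ⊤ : Submodule R ω)) 0) = Module.length R N ∧
      Module.length R N ≠ ⊤ := by
  let P : (N : Type) → [AddCommGroup N] → [Module R N] → Prop := fun N _ _ =>
    Module.Finite R N → I ≤ Module.annihilator R N →
      Module.length R (EE R N (ω ⧸ (I • ⊤ : Submodule R ω)) 0) = Module.length R N ∧
      Module.length R N ≠ ⊤
  have zero : ∀ (N : Type) [AddCommGroup N] [Module R N] [Subsingleton N], P N := by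
    intro N _ _ _ _ _
    have : Subsingleton (EE R N (ω ⧸ (I • ⊤ : Submodule R ω)) 0) := ext_subsingleton_left 0
    simp
  have extn : ∀ (N₁ N₂ N₃ : Type) [AddCommGroup N₁] [Module R N₁] [AddCommGroup N₂] [Module R N₂]
      [AddCommGroup N₃] [Module R N₃] (f : N₁ →ₗ[R] N₂) (g : N₂ →ₗ[R] N₃), SES f g →
      P N₁ → P N₃ → P N₂ := by
    intro N₁ N₂ N₃ _ _ _ _ _ _ f g S h1 h3 _ hI
    have f1 : Module.Finite R N₁ := Module.Finite.of_injective f S.inj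
    have f3 : Module.Finite R N₃ := Module.Finite.of_surjective g S.surj
    obtain ⟨e1, t1⟩ := h1 f1 (hI.trans (f.annihilator_le_of_injective S.inj))
    obtain ⟨e3, t3⟩ := h3 f3 (hI.trans (g.annihilator_le_of_surjective S.surj))
    have hs := h.surj N₁ N₂ f S.inj hI fun q hq => h.chgt_eq_zero hdim (hI.trans hq)
    rw [Nat.sub_self] at hs
    rw [Module.length_eq_add_of_exact f g S.inj S.surj S.exact,
      Module.length_eq_add_of_exact _ _ (S.injL _) hs (S.exactL₂ _ 0), e1, e3, add_comm]
    exact ⟨rfl, by simp [t1, t3]⟩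
  refine devissage P zero extn N ?_ hf hN
  intro q hq Q _ _ e _ _
  obtain ⟨e1, e2⟩ := h.length_quotient_prime hdim (hN.trans hq)
  rw [(extLEquiv (ω ⧸ (I • ⊤ : Submodule R ω)) e 0).symm.length_eq, e1, e.length_eq, e2]
  simp

end Canonical

section Centralizer

variable {R : Type} [CommRing R] [IsNoetherianRing R] [IsLocalRing R] {d : ℕ}
  {ω : Type} [AddCommGroup ω] [Module R ω]

omit [IsNoetherianRing R] [IsLocalRing R] in
lemma le_annihilator_quotient (I : Ideal R) :
    I ≤ Module.annihilator R (ω ⧸ (I • ⊤ : Submodule R ω)) := by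
  intro a ha
  rw [Module.mem_annihilator]
  intro v
  obtain ⟨v, rfl⟩ := Submodule.mkQ_surjective _ v
  rw [← map_smul, Submodule.mkQ_apply, Submodule.Quotient.mk_eq_zero]
  exact Submodule.smul_mem_smul ha trivial

lemma RegCanon.mem_of_smul {I : Ideal R} (hdim : ringKrullDim R = d) (h : RegCanon R ω d d I)
    (a : R) (ha : ∀ w : ω, a • w ∈ (I • ⊤ : Submodule R ω)) : a ∈ I := by
  by_contra haI
  let c : R ⧸ I := Ideal.Quotient.mk I a
  have hc : c ≠ 0 := fun h => haI (Ideal.Quotient.eq_zero_iff_mem.mp h)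
  let N := Submodule.span R {c}
  have hN : I ≤ Module.annihilator R (R ⧸ I) := Ideal.annihilator_quotient.ge
  have hN' : I ≤ Module.annihilator R N :=
    hN.trans (N.subtype.annihilator_le_of_injective N.injective_subtype)
  have hpos : Nontrivial (EE R N (ω ⧸ (I • ⊤ : Submodule R ω)) 0) := by
    rw [← Module.length_pos_iff (R := R), (h.length_hom hdim N hN').1, Module.length_pos_iff]
    exact ⟨⟨⟨c, Submodule.mem_span_singleton_self c⟩, 0, fun h => hc (congrArg Subtype.val h)⟩⟩
  obtain ⟨e, he⟩ := exists_ne (0 : EE R N (ω ⧸ (I • ⊤ : Submodule R ω)) 0)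
  have hs := h.surj N (R ⧸ I) N.subtype N.injective_subtype hN fun q hq =>
    h.chgt_eq_zero hdim (hN.trans hq)
  rw [Nat.sub_self] at hs
  obtain ⟨g, rfl⟩ := hs e
  obtain ⟨g, rfl⟩ := (homEquivExt _ _).surjective g
  refine he ?_
  rw [extL_homEquivExt, LinearEquiv.map_eq_zero_iff]
  ext ⟨n, hn⟩
  obtain ⟨r, rfl⟩ := Submodule.mem_span_singleton.mp hn
  have h1 : g c = 0 := by
    obtain ⟨w, hw⟩ := Submodule.mkQ_surjective _ (g (Ideal.Quotient.mk I 1))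
    have : c = a • Ideal.Quotient.mk I 1 := by
      change _ = Ideal.Quotient.mk I (a * 1)
      rw [mul_one]
    rw [this, map_smul, ← hw, ← map_smul, Submodule.mkQ_apply, Submodule.Quotient.mk_eq_zero]
    exact ha w
  simp [h1]

lemma RegCanon.centralizer [Module.Finite R ω] {I : Ideal R} (hdim : ringKrullDim R = d)
    (h : RegCanon R ω d d I) : Centralizer R ω I where
  mem := h.mem_of_smul hdim
  exists_smul := by
    let G := ω ⧸ (I • ⊤ : Submodule R ω)
    let f : R →ₗ[R] (G →ₗ[R] G) := LinearMap.lsmul R G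
    let act : (R ⧸ I) →ₗ[R] (G →ₗ[R] G) := Submodule.liftQ I f (by
      intro a ha
      rw [LinearMap.mem_ker]
      exact LinearMap.ext fun v =>
        Module.mem_annihilator.mp (le_annihilator_quotient (ω := ω) I ha) _)
    have hact : Function.Injective act := by
      rw [injective_iff_map_eq_zero]
      intro a ha
      obtain ⟨a, rfl⟩ := Ideal.Quotient.mk_surjective a
      refine Ideal.Quotient.eq_zero_iff_mem.mpr (h.mem_of_smul hdim a fun w => ?_)
      have h1 : a • (Submodule.Quotient.mk w : G) = 0 := LinearMap.congr_fun ha _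
      rwa [← Submodule.Quotient.mk_smul, Submodule.Quotient.mk_eq_zero] at h1
    have hev : Function.Surjective
        (LinearMap.applyₗ (R := R) (M₂ := G) (Ideal.Quotient.mk I 1)) := by
      intro v
      refine ⟨Submodule.liftQ I (LinearMap.toSpanSingleton R G v) ?_, ?_⟩
      · intro a ha
        exact Module.mem_annihilator.mp (le_annihilator_quotient I ha) _
      · change (1 : R) • v = v
        rw [one_smul]
    have hG := h.length_hom hdim G (le_annihilator_quotient I)
    have hQ := h.length_hom hdim (R ⧸ I) Ideal.annihilator_quotient.ge
    rw [← (homEquivExt G G).length_eq] at hG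
    rw [← (homEquivExt (R ⧸ I) G).length_eq] at hQ
    have hle : Module.length R (G →ₗ[R] G) ≤ Module.length R (R ⧸ I) := by
      rw [hG.1, ← hQ.1]
      exact Module.length_le_of_surjective _ hev
    have hge := Module.length_le_of_injective act hact
    have hadd := Module.length_eq_add_of_exact act (LinearMap.range act).mkQ hact
      (Submodule.mkQ_surjective _) (LinearMap.exact_map_mkQ_range act)
    have hsub : Subsingleton ((G →ₗ[R] G) ⧸ LinearMap.range act) := by
      rw [← Module.length_eq_zero_iff (R := R)]
      rw [le_antisymm hle hge] at hadd
      exact ENat.add_right_injective_of_ne_top hQ.2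
        (show _ + _ = _ + _ by rw [add_zero]; exact hadd.symm)
    have hact' : Function.Surjective act := by
      rw [← LinearMap.range_eq_top]
      exact Submodule.Quotient.subsingleton_iff.mp hsub
    intro φ
    have hφ : (I • ⊤ : Submodule R ω) ≤ LinearMap.ker φ := by
      rw [Submodule.smul_le]
      intro a ha w _
      rw [LinearMap.mem_ker, map_smul]
      exact Module.mem_annihilator.mp (le_annihilator_quotient I ha) _
    obtain ⟨a, ha⟩ := hact' (Submodule.liftQ _ φ hφ)
    obtain ⟨a, rfl⟩ := Ideal.Quotient.mk_surjective a
    refine ⟨a, LinearMap.ext fun w => ?_⟩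
    exact (LinearMap.congr_fun ha (Submodule.Quotient.mk w)).symm

lemma Centralizer.of_step [Module.Finite R ω] {I : Ideal R} {x : R} (hx : x ∈ maximalIdeal R)
    (hregω : ∀ v : ω, x • v ∈ (I • ⊤ : Submodule R ω) → v ∈ (I • ⊤ : Submodule R ω))
    (h : Centralizer R ω (I ⊔ Ideal.span {x})) : Centralizer R ω I where
  mem := by
    let J : Ideal R :=
      { carrier := {a | ∀ w : ω, a • w ∈ (I • ⊤ : Submodule R ω)}
        add_mem' := fun ha hb w => by rw [add_smul]; exact add_mem (ha w) (hb w)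
        zero_mem' := fun w => by rw [zero_smul]; exact zero_mem _
        smul_mem' := fun c a ha w => by
          rw [smul_eq_mul, mul_smul]; exact Submodule.smul_mem _ _ (ha w) }
    refine le_of_forall_exists_add_smul (N := I) (N' := J) (IsNoetherian.noetherian J) hx ?_
    intro a ha
    have h1 := h.mem a fun w => Submodule.smul_mono_left le_sup_left (ha w)
    obtain ⟨i, hi, b, rfl⟩ := (mem_sup_span_singleton_iff I x a).mp h1
    refine ⟨i, hi, b, fun w => hregω _ ?_, rfl⟩
    have h2 := sub_mem (ha w) (Submodule.smul_mem_smul hi (Submodule.mem_top (x := w)))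
    rwa [add_smul, add_sub_cancel_left, smul_eq_mul, mul_smul] at h2
  exists_smul := by
    intro φ
    have S := SES.canonQuotient hregω
    have key : (⊤ : Submodule R (ω →ₗ[R] ω ⧸ (I • ⊤ : Submodule R ω))) ≤
        Submodule.span R {(I • ⊤ : Submodule R ω).mkQ} := by
      refine le_of_forall_exists_add_smul Module.Finite.fg_top hx fun φ _ => ?_
      obtain ⟨a, ha⟩ := h.exists_smul (Submodule.factor
        (Submodule.smul_mono_left (le_sup_left : I ≤ I ⊔ Ideal.span {x})) ∘ₗ φ)
      have hz := (homEquivExt ω _).injective.eq_iff.mpr ha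
      have h0 : extR ω (Submodule.factor (Submodule.smul_mono_left
          (le_sup_left : I ≤ I ⊔ Ideal.span {x}))) 0
          (homEquivExt ω _ (φ - a • (I • ⊤ : Submodule R ω).mkQ)) = 0 := by
        rw [extR_homEquivExt, LinearEquiv.map_eq_zero_iff, LinearMap.comp_sub, ha, sub_eq_zero]
        rfl
      obtain ⟨e, he⟩ := (S.exactR₂ ω 0 _).mp h0
      obtain ⟨ψ, rfl⟩ := (homEquivExt ω _).surjective e
      rw [extR_homEquivExt, (homEquivExt ω _).injective.eq_iff, eq_sub_iff_add_eq'] at he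
      exact ⟨_, Submodule.smul_mem _ a (Submodule.mem_span_singleton_self _), ψ, trivial, he.symm⟩
    obtain ⟨a, ha⟩ := Submodule.mem_span_singleton.mp (key (Submodule.mem_top (x := φ)))
    exact ⟨a, ha.symm⟩

lemma RegCanon.exists_regular [Module.Finite R ω] {r : ℕ} {I : Ideal R}
    (h : RegCanon R ω d r I) (hr : r < d) : ∃ x ∈ maximalIdeal R,
    (∀ v : R, x * v ∈ I → v ∈ I) ∧
      ∀ v : ω, x • v ∈ (I • ⊤ : Submodule R ω) → v ∈ (I • ⊤ : Submodule R ω) := by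
  have h1 : Subsingleton (EE R (ResidueField R) ((R ⧸ I) × (ω ⧸ (I • ⊤ : Submodule R ω))) 0) :=
    (SES.mk LinearMap.inl_injective .inl_snd LinearMap.snd_surjective).ssR₂ _ 0
      (h.depth 0 (by lia)) (h.depth_canon 0 (by lia))
  obtain ⟨x, hx, hreg⟩ := exists_regular_of_hom_residueField h1
  refine ⟨x, hx, fun v hv => ?_, fun v hv => ?_⟩
  · have := hreg (Ideal.Quotient.mk I v, 0) (Prod.ext (Ideal.Quotient.eq_zero_iff_mem.mpr hv)
      (smul_zero _))
    exact Ideal.Quotient.eq_zero_iff_mem.mp (Prod.ext_iff.mp this).1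
  · have := hreg (0, Submodule.Quotient.mk v) (Prod.ext (smul_zero _)
      ((Submodule.Quotient.mk_eq_zero _).mpr hv))
    exact (Submodule.Quotient.mk_eq_zero _).mp (Prod.ext_iff.mp this).2

lemma Canon.centralizer (h : Canon R d ω) : Centralizer R ω (⊥ : Ideal R) := by
  have := h.finite
  suffices ∀ c r (I : Ideal R), r + c = d → RegCanon R ω d r I → Centralizer R ω I from
    this d 0 ⊥ (by lia) h.regCanon_bot
  intro c
  induction c with
  | zero =>
    intro r I hr hI
    obtain rfl : r = d := hr
    exact hI.centralizer h.dim
  | succ c ih =>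
    intro r I hr hI
    obtain ⟨x, hx, h1, h2⟩ := hI.exists_regular (by lia)
    exact .of_step hx h2 (ih (r + 1) _ (by lia) (hI.step h.dim (by lia) hx h1 h2))

theorem Canon.eq_zero_of_smul (h : Canon R d ω) (a : R) (ha : ∀ w : ω, a • w = 0) : a = 0 := by
  simpa using h.centralizer.mem a fun w => by rw [ha]; exact zero_mem _

theorem Canon.exists_smul (h : Canon R d ω) (φ : ω →ₗ[R] ω) : ∃ a : R, ∀ w, φ w = a • w := by
  obtain ⟨a, ha⟩ := h.centralizer.exists_smul
    (((⊥ : Ideal R) • ⊤ : Submodule R ω).mkQ ∘ₗ φ)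
  refine ⟨a, fun w => ?_⟩
  have h1 := LinearMap.congr_fun ha w
  rw [LinearMap.comp_apply, LinearMap.smul_apply, ← map_smul, ← sub_eq_zero, ← map_sub,
    Submodule.mkQ_apply, Submodule.Quotient.mk_eq_zero] at h1
  simpa [sub_eq_zero] using h1

end Centralizer

section Pi

variable {A : Type} [CommRing A] {M N : Type} [AddCommGroup M] [Module A M]
  [AddCommGroup N] [Module A N]

lemma SES.pi_succ (M : Type) [AddCommGroup M] [Module A M] (n : ℕ) :
    SES (LinearMap.single A (fun _ : Fin (n + 1) => M) 0)
      (LinearMap.funLeft A M (Fin.succ : Fin n → Fin (n + 1))) where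
  inj := Pi.single_injective (M := fun _ : Fin (n + 1) => M) 0
  exact := by
    intro v
    constructor
    · intro hv
      refine ⟨v 0, funext fun i => ?_⟩
      refine Fin.cases ?_ (fun i => ?_) i
      · simp
      · simpa using (congrFun hv i).symm
    · rintro ⟨v, rfl⟩
      ext i
      simp
  surj := LinearMap.funLeft_surjective_of_injective A M _ (Fin.succ_injective n)

lemma ext_subsingleton_pi_right {j : ℕ} (h : Subsingleton (EE A M N j)) (n : ℕ) :
    Subsingleton (EE A M (Fin n → N) j) := by
  induction n with
  | zero => exact ext_subsingleton_right j
  | succ n ih => exact (SES.pi_succ N n).ssR₂ M j h ih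

lemma ext_subsingleton_pi_left {j : ℕ} (h : Subsingleton (EE A M N j)) (n : ℕ) :
    Subsingleton (EE A (Fin n → M) N j) := by
  induction n with
  | zero => exact ext_subsingleton_left j
  | succ n ih => exact (SES.pi_succ M n).ssL₂ N j h ih

/-- The dual of a free module. -/
noncomputable def piDual (A : Type) [CommRing A] (ω : Type) [AddCommGroup ω] [Module A ω] (n : ℕ) :
    (Fin n → ω) ≃ₗ[A] ((Fin n → A) →ₗ[A] ω) :=
  (Pi.basisFun A (Fin n)).constr A

end Pi

section Dual

variable {A : Type} [CommRing A] {K F T ω : Type} [AddCommGroup K] [Module A K]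
  [AddCommGroup F] [Module A F] [AddCommGroup T] [Module A T] [AddCommGroup ω] [Module A ω]
  {f : K →ₗ[A] F} {g : F →ₗ[A] T}

lemma SES.dual (h : SES f g) (ω : Type) [AddCommGroup ω] [Module A ω] :
    SES (dmap A ω g) (dmap A ω f).rangeRestrict where
  inj := by
    intro a b hab
    exact LinearMap.ext fun t => by
      obtain ⟨x, rfl⟩ := h.surj t
      exact LinearMap.congr_fun hab x
  exact := by
    intro a
    rw [← Submodule.coe_eq_zero]
    change dmap A ω f a = 0 ↔ _
    constructor
    · intro ha
      have hker : LinearMap.ker g ≤ LinearMap.ker a := by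
        intro x hx
        obtain ⟨y, rfl⟩ := (h.exact x).mp hx
        exact LinearMap.congr_fun ha y
      refine ⟨(LinearMap.ker g).liftQ a hker ∘ₗ
        (g.quotKerEquivOfSurjective h.surj).symm.toLinearMap, ?_⟩
      ext x
      change (LinearMap.ker g).liftQ a hker ((g.quotKerEquivOfSurjective h.surj).symm (g x)) = a x
      rw [LinearMap.quotKerEquivOfSurjective_symm_apply]
      rfl
    · rintro ⟨a, rfl⟩
      exact LinearMap.ext fun x => by
        change a (g (f x)) = 0
        rw [h.exact.apply_apply_eq_zero, map_zero]
  surj := LinearMap.surjective_rangeRestrict _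

lemma SES.pz_dual_quotient {p : Ideal A} (h : SES f g) (hT : PZ p (EE A T ω 1)) :
    PZ p ((K →ₗ[A] ω) ⧸ LinearMap.range (dmap A ω f)) := by
  have hker : LinearMap.ker (h.deltaL ω 0 ∘ₗ (homEquivExt K ω).toLinearMap) =
      LinearMap.range (dmap A ω f) := by
    ext a
    rw [LinearMap.mem_ker]
    refine (h.exactL₁ ω 0 (homEquivExt K ω a)).trans ?_
    constructor
    · rintro ⟨e, he⟩
      obtain ⟨b, rfl⟩ := (homEquivExt F ω).surjective e
      rw [extL_homEquivExt] at he
      exact ⟨b, (homEquivExt K ω).injective he⟩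
    · rintro ⟨b, rfl⟩
      exact ⟨homEquivExt F ω b, extL_homEquivExt f b⟩
  rw [← hker]
  refine hT.of_injective ((LinearMap.ker _).liftQ _ le_rfl) ?_
  rw [← LinearMap.ker_eq_bot, Submodule.ker_liftQ_eq_bot' _ _ rfl]

lemma SES.exists_free [IsNoetherianRing A] (T : Type) [AddCommGroup T] [Module A T]
    [Module.Finite A T] : ∃ (n : ℕ) (g : (Fin n → A) →ₗ[A] T),
      SES (LinearMap.ker g).subtype g := by
  obtain ⟨n, g, hg⟩ := Module.Finite.exists_fin' A T
  exact ⟨n, g, .of_surjective hg⟩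

end Dual

section DualExt

variable {R : Type} [CommRing R] [IsNoetherianRing R] [IsLocalRing R] {d : ℕ}
  {ω : Type} [AddCommGroup ω] [Module R ω]

lemma Canon.ext_dual_free (h : Canon R d ω) {W : Type} [AddCommGroup W] [Module R W]
    [Module.Finite R W] (hW : FID R W) (n i : ℕ) :
    Subsingleton (EE R ((Fin n → R) →ₗ[R] ω) W (i + 1)) := by
  have := h.finite
  refine (ext_subsingleton_congr_left (piDual R ω n) (i + 1)).mp ?_
  exact ext_subsingleton_pi_left
    (hW.ext_subsingleton h.dim h.depth_ring h.depth (i + 1) (by lia)) n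

theorem Canon.pz_ext_dual (h : Canon R d ω) {W : Type} [AddCommGroup W] [Module R W]
    [Module.Finite R W] (hW : FID R W) (p : PrimeSpectrum R) (i : ℕ) (T : Type) [AddCommGroup T]
    [Module R T] [Module.Finite R T] (hT : ∀ j, PZ p.asIdeal (EE R T ω (j + 1))) :
    PZ p.asIdeal (EE R (T →ₗ[R] ω) W (i + 1)) := by
  have := h.finite
  obtain ⟨c, hc⟩ : ∃ c, d < i + 1 + c := ⟨d, by lia⟩
  induction c generalizing i T with
  | zero =>
    refine hW.pz_ext h.dim h.depth_ring p _ _ ?_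
    exact lt_of_le_of_lt (hgt_le h.dim p) (by exact_mod_cast hc)
  | succ c ih =>
    obtain ⟨n, g, S⟩ := SES.exists_free (A := R) T
    have hK : ∀ j, PZ p.asIdeal (EE R (LinearMap.ker g) ω (j + 1)) := fun j =>
      have := ext_subsingleton_of_projective (A := R) (M := Fin n → R) (Y := ω) j
      S.pzL₁ ω (j + 1) .of_subsingleton (hT (j + 1))
    have hB := (SES.of_submodule (LinearMap.range (dmap R ω (LinearMap.ker g).subtype))).pzL₁ W
      (i + 1 + 1) (ih (i + 1) _ hK (by lia)) ((S.pz_dual_quotient (hT 0)).ext_left _)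
    have := h.ext_dual_free hW n i
    exact (S.dual ω).pzL₁ W (i + 1) .of_subsingleton hB

end DualExt

section Biduality

variable {R : Type} [CommRing R] [IsNoetherianRing R] [IsLocalRing R] {d : ℕ}
  {ω : Type} [AddCommGroup ω] [Module R ω]

theorem SES.pz_ext_range_dual (h : Canon R d ω) {W : Type} [AddCommGroup W] [Module R W]
    [Module.Finite R W] (hW : FID R W) (p : PrimeSpectrum R) (i : ℕ) {n : ℕ} {K T : Type}
    [AddCommGroup K] [Module R K] [AddCommGroup T] [Module R T] [Module.Finite R T]
    {f : K →ₗ[R] (Fin n → R)} {g : (Fin n → R) →ₗ[R] T} (S : SES f g)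
    (hT : ∀ j, PZ p.asIdeal (EE R T ω (j + 1))) :
    PZ p.asIdeal (EE R (LinearMap.range (dmap R ω f)) W (i + 1)) := by
  have := h.finite
  have : Module.Finite R K := Module.Finite.of_injective f S.inj
  have hK : ∀ j, PZ p.asIdeal (EE R K ω (j + 1)) := fun j =>
    have := ext_subsingleton_of_projective (A := R) (M := Fin n → R) (Y := ω) j
    S.pzL₁ ω (j + 1) .of_subsingleton (hT (j + 1))
  exact (SES.of_submodule (LinearMap.range (dmap R ω f))).pzL₁ W
      (i + 1) (h.pz_ext_dual hW p i _ hK) ((S.pz_dual_quotient (hT 0)).ext_left _)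

lemma Canon.delta_free_injective (h : Canon R d ω) (n : ℕ) :
    Function.Injective (deltaMap R ω (Fin n → R)) := by
  rw [injective_iff_map_eq_zero]
  intro x hx
  ext i
  refine h.eq_zero_of_smul _ fun w => ?_
  exact LinearMap.congr_fun hx ((LinearMap.proj i : (Fin n → R) →ₗ[R] R).smulRight w)

lemma Canon.delta_free_surjective (h : Canon R d ω) (n : ℕ) :
    Function.Surjective (deltaMap R ω (Fin n → R)) := by
  intro χ
  choose x hx using fun i : Fin n => h.exists_smul (χ ∘ₗ (piDual R ω n).toLinearMap ∘ₗ
    LinearMap.single R (fun _ : Fin n => ω) i)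
  refine ⟨x, LinearMap.ext fun a => ?_⟩
  obtain ⟨v, rfl⟩ := (piDual R ω n).surjective a
  have : (χ ∘ₗ (piDual R ω n).toLinearMap) v = ∑ i, x i • v i := by
    conv_lhs => rw [← Finset.univ_sum_single v, map_sum]
    exact Finset.sum_congr rfl fun i _ => hx i (v i)
  refine Eq.trans ?_ this.symm
  change piDual R ω n v x = _
  simp [piDual, Module.Basis.constr_apply_fintype]

lemma Canon.pz_quotient_range_delta (h : Canon R d ω) (p : PrimeSpectrum R) (T : Type)
    [AddCommGroup T] [Module R T] [Module.Finite R T]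
    (hT : ∀ j, PZ p.asIdeal (EE R T ω (j + 1))) :
    PZ p.asIdeal (((T →ₗ[R] ω) →ₗ[R] ω) ⧸ LinearMap.range (deltaMap R ω T)) := by
  have := h.finite
  obtain ⟨n, g, S⟩ := SES.exists_free (A := R) T
  have h1 := (S.dual ω).pz_dual_quotient (S.pz_ext_range_dual h h.fid p 0 hT)
  have hle : LinearMap.range (dmap R ω (dmap R ω g)) ≤ LinearMap.range (deltaMap R ω T) := by
    rintro _ ⟨χ, rfl⟩
    obtain ⟨x, rfl⟩ := h.delta_free_surjective n χ
    exact ⟨g x, rfl⟩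
  exact h1.of_surjective _ (Submodule.factor_surjective hle)

lemma Canon.pz_ker_delta (h : Canon R d ω) (p : PrimeSpectrum R) (T : Type)
    [AddCommGroup T] [Module R T] [Module.Finite R T]
    (hT : ∀ j, PZ p.asIdeal (EE R T ω (j + 1))) :
    PZ p.asIdeal (LinearMap.ker (deltaMap R ω T)) := by
  have := h.finite
  obtain ⟨n, g, S⟩ := SES.exists_free (A := R) T
  rintro ⟨t, ht⟩
  obtain ⟨x, rfl⟩ := S.surj t
  set f := (LinearMap.ker g).subtype
  have hK : ∀ j, PZ p.asIdeal (EE R (LinearMap.ker g) ω (j + 1)) := fun j =>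
    have := ext_subsingleton_of_projective (A := R) (M := Fin n → R) (Y := ω) j
    S.pzL₁ ω (j + 1) .of_subsingleton (hT (j + 1))
  obtain ⟨β, hβ⟩ : ∃ β, dmap R ω (dmap R ω f).rangeRestrict β = deltaMap R ω _ x := by
    refine (((S.dual ω).dual ω).exact _).mp ?_
    exact Subtype.ext ht
  have hext := (SES.of_submodule (LinearMap.range (dmap R ω f))).pz_dual_quotient (ω := ω)
    ((S.pz_dual_quotient (hT 0)).ext_left 1)
  obtain ⟨s, hs, hsβ⟩ := hext (Submodule.Quotient.mk β)
  rw [← Submodule.Quotient.mk_smul, Submodule.Quotient.mk_eq_zero] at hsβ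
  obtain ⟨β', hβ'⟩ := hsβ
  obtain ⟨s', hs', hsβ'⟩ := h.pz_quotient_range_delta p _ hK (Submodule.Quotient.mk β')
  rw [← Submodule.Quotient.mk_smul, Submodule.Quotient.mk_eq_zero] at hsβ'
  obtain ⟨y, hy⟩ := hsβ'
  refine ⟨s' * s, p.2.mul_notMem hs' hs, Subtype.ext ?_⟩
  have key : (s' * s) • x = f y := by
    refine h.delta_free_injective n (LinearMap.ext fun a => ?_)
    rw [map_smul, ← hβ]
    have e1 := LinearMap.congr_fun hy (dmap R ω f a)
    have e2 := LinearMap.congr_fun hβ' ((dmap R ω f).rangeRestrict a)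
    change a (f y) = s' • β' (dmap R ω f a) at e1
    change β' (dmap R ω f a) = s • β _ at e2
    change (s' * s) • β _ = a (f y)
    rw [e1, e2, mul_smul]
  change (s' * s) • g x = 0
  rw [← map_smul, key]
  exact y.2

end Biduality

section Generation

variable {R : Type} [CommRing R] [IsNoetherianRing R] [IsLocalRing R] {d : ℕ}
  {ω : Type} [AddCommGroup ω] [Module R ω]

lemma Canon.ext_canon (h : Canon R d ω) (j : ℕ) : Subsingleton (EE R ω ω (j + 1)) :=
  have := h.finite
  h.fid.ext_subsingleton h.dim h.depth_ring h.depth (j + 1) (by lia)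

/-- `R ≃ Hom(ω, ω)`. -/
noncomputable def Canon.ringEquiv (h : Canon R d ω) : R ≃ₗ[R] (ω →ₗ[R] ω) :=
  .ofBijective (LinearMap.lsmul R ω)
    ⟨(injective_iff_map_eq_zero _).mpr fun a ha =>
      h.eq_zero_of_smul a fun w => LinearMap.congr_fun ha w,
    fun φ => (h.exists_smul φ).imp fun _ ha => LinearMap.ext fun w => (ha w).symm⟩

lemma Canon.exists_map (h : Canon R d ω) {W : Type} [AddCommGroup W] [Module R W]
    [Module.Finite R W] (hW : FID R W) :
    ∃ m, ∀ w : W, ∃ H : (Fin m → ω) →ₗ[R] W, w ∈ LinearMap.range H := by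
  have := h.finite
  obtain ⟨m, g, S⟩ := SES.exists_free (A := R) ω
  refine ⟨m, fun w => ?_⟩
  have h0 : Subsingleton (EE R (LinearMap.range (dmap R ω (LinearMap.ker g).subtype)) W 1) :=
    (S.pz_ext_range_dual h hW (closedPoint R) 0 fun j =>
      have := h.ext_canon j; .of_subsingleton).subsingleton
  let φ : (ω →ₗ[R] ω) →ₗ[R] W := LinearMap.toSpanSingleton R W w ∘ₗ h.ringEquiv.symm.toLinearMap
  obtain ⟨e, he⟩ := ((S.dual ω).exactL₁ W 0 (homEquivExt _ _ φ)).mp (Subsingleton.elim _ _)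
  obtain ⟨ψ, rfl⟩ := (homEquivExt _ _).surjective e
  rw [extL_homEquivExt, (homEquivExt _ _).injective.eq_iff] at he
  refine ⟨ψ ∘ₗ (piDual R ω m).toLinearMap, (piDual R ω m).symm (dmap R ω g (h.ringEquiv 1)), ?_⟩
  have := LinearMap.congr_fun he (h.ringEquiv 1)
  simpa [φ] using this

theorem Canon.exists_cover (h : Canon R d ω) {W : Type} [AddCommGroup W] [Module R W]
    [Module.Finite R W] (hW : FID R W) :
    ∃ (n : ℕ) (π : (Fin n → ω) →ₗ[R] W), Function.Surjective π ∧ FID R (LinearMap.ker π) := by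
  obtain ⟨m, hm⟩ := h.exists_map hW
  obtain ⟨l, q, hq⟩ := Module.Finite.exists_fin' R W
  choose H y hy using fun i : Fin l => hm (q (Pi.single i 1))
  let π' : (Fin l → Fin m → ω) →ₗ[R] W := LinearMap.lsum R (fun _ => Fin m → ω) R H
  let e : (Fin (l * m) → ω) ≃ₗ[R] (Fin l → Fin m → ω) :=
    (LinearEquiv.funCongrLeft R ω finProdFinEquiv).trans (LinearEquiv.curry R ω (Fin l) (Fin m))
  have hπ : Function.Surjective (π' ∘ₗ e.toLinearMap) := by
    refine Function.Surjective.comp (g := π') (f := e) (fun w => ?_) e.surjective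
    obtain ⟨x, rfl⟩ := hq w
    refine ⟨fun i => x i • y i, ?_⟩
    have : x = ∑ i, x i • Pi.single i 1 := by
      simpa using pi_eq_sum_univ' x
    conv_rhs => rw [this, map_sum]
    simp [π', LinearMap.lsum_apply, hy]
  refine ⟨l * m, _, hπ, ?_⟩
  obtain ⟨a, ha⟩ := hW
  obtain ⟨b, hb⟩ := h.fid
  refine ⟨max a b + 1, fun N _ _ j hj => ?_⟩
  obtain ⟨j, rfl⟩ : ∃ i, j = i + 1 := ⟨j - 1, by lia⟩
  exact (SES.of_surjective hπ).ssR₁ N j (ha N j (by lia))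
    (ext_subsingleton_pi_right (hb N (j + 1) (by lia)) _)

lemma FID.ext_subsingleton_of_lt (hW : FID R ω) [Module.Finite R ω] (hdim : ringKrullDim R = d)
    (hCM : ∀ j < d, Subsingleton (EE R (ResidueField R) R j)) (N : Type) [AddCommGroup N]
    [Module R N] [Module.Finite R N] (j : ℕ) (hj : d < j) : Subsingleton (EE R N ω j) :=
  (hW.pz_ext hdim hCM (closedPoint R) N j
    (lt_of_le_of_lt (hgt_le hdim _) (by exact_mod_cast hj))).subsingleton

lemma Canon.ext_subsingleton_of_ext_canon (h : Canon R d ω) {W : Type} [AddCommGroup W]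
    [Module R W] [Module.Finite R W] (hW : ∀ j, Subsingleton (EE R W ω (j + 1))) (j : ℕ)
    {V : Type} [AddCommGroup V] [Module R V] [Module.Finite R V] (hV : FID R V) :
    Subsingleton (EE R W V (j + 1)) := by
  have := h.finite
  obtain ⟨c, hc⟩ : ∃ c, d < j + 1 + c := ⟨d, by lia⟩
  induction c generalizing j V with
  | zero => exact hV.ext_subsingleton_of_lt h.dim h.depth_ring W _ hc
  | succ c ih =>
    obtain ⟨n, π, hπ, hk⟩ := h.exists_cover hV
    exact (SES.of_surjective hπ).ssR₃ W (j + 1) (ext_subsingleton_pi_right (hW j) n)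
      (ih (j + 1) hk (by lia))

end Generation

section Main

variable {R : Type} [CommRing R] [IsNoetherianRing R] [IsLocalRing R] {d : ℕ}
  {ω : Type} [AddCommGroup ω] [Module R ω]

lemma Canon.projective_dual_pi (h : Canon R d ω) (n : ℕ) :
    Module.Projective R ((Fin n → ω) →ₗ[R] ω) :=
  .of_equiv ((LinearEquiv.piCongrRight fun _ : Fin n => h.ringEquiv).trans
    (LinearMap.lsum R (fun _ : Fin n => ω) R))

/-- Vanishing of `Ext` out of modules with small support. -/
lemma ext_subsingleton_of_pz (hdim : ringKrullDim R = d) {Z : Type} [AddCommGroup Z] [Module R Z]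
    (hZ : IsMCM R d Z) {Q : Type} [AddCommGroup Q] [Module R Q] [Module.Finite R Q] {m : ℕ}
    (hQ : ∀ p : PrimeSpectrum R, hgt p ≤ m → PZ p.asIdeal Q) : Subsingleton (EE R Q Z m) := by
  have := hZ.1
  refine ext_subsingleton_of_chgt hdim hZ.ext_subsingleton Q m fun q hq => ?_
  have h1 := hgt_add_chgt_le hdim q
  by_contra h2
  obtain ⟨s, hs, hsQ⟩ := (hQ q (by lia)).exists_smul
  exact hs (hq (Module.mem_annihilator.mpr hsQ))

lemma Canon.projective_dual (h : Canon R d ω) {W : Type} [AddCommGroup W] [Module R W]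
    [Module.Finite R W] (hW : FID R W) (hWω : ∀ j, Subsingleton (EE R W ω (j + 1))) :
    Module.Projective R (W →ₗ[R] ω) := by
  have := h.finite
  obtain ⟨n, π, hπ, hk⟩ := h.exists_cover hW
  have h0 := h.ext_subsingleton_of_ext_canon hWω 0 hk
  obtain ⟨e, he⟩ := ((SES.of_surjective hπ).exactR₃ W 0 (homEquivExt W W LinearMap.id)).mp
    (Subsingleton.elim _ _)
  obtain ⟨σ, rfl⟩ := (homEquivExt _ _).surjective e
  rw [extR_homEquivExt, (homEquivExt _ _).injective.eq_iff] at he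
  have := h.projective_dual_pi n
  refine .of_split (dmap R ω π) (dmap R ω σ) ?_
  ext a w
  exact congrArg a (LinearMap.congr_fun he w)

theorem Canon.ext_dual_subsingleton (h : Canon R d ω) {Z : Type} [AddCommGroup Z] [Module R Z]
    (hZ : IsMCM R d Z) (s m : ℕ) {W : Type} [AddCommGroup W] [Module R W]
    [Module.Finite R W] (hW : FID R W) (hs : ∀ j > s, Subsingleton (EE R W ω j))
    (hp : ∀ (p : PrimeSpectrum R) (j : ℕ), hgt p ≤ j + m + 3 → PZ p.asIdeal (EE R W ω (j + 1))) :
    Subsingleton (EE R (W →ₗ[R] ω) Z (m + 1)) := by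
  have := h.finite
  induction s generalizing m W with
  | zero =>
    have := h.projective_dual hW fun j => hs (j + 1) (by lia)
    exact ext_subsingleton_of_projective m
  | succ s ih =>
    obtain ⟨n, π, hπ, hk⟩ := h.exists_cover hW
    have S := SES.of_surjective hπ
    have hω : ∀ j, Subsingleton (EE R (Fin n → ω) ω (j + 1)) := fun j =>
      ext_subsingleton_pi_left (h.ext_canon j) n
    have hK : Subsingleton (EE R (LinearMap.ker π →ₗ[R] ω) Z (m + 1 + 1)) := by
      refine ih (m + 1) hk (fun j hj => ?_) fun p j hj => ?_
      · obtain ⟨j, rfl⟩ : ∃ i, j = i + 1 := ⟨j - 1, by lia⟩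
        exact S.ssL₁ ω (j + 1) (hω j) (hs _ (by lia))
      · have := hω j
        exact S.pzL₁ ω (j + 1) .of_subsingleton (hp p (j + 1) (by lia))
    have hQ := ext_subsingleton_of_pz h.dim hZ (m := m + 1 + 1 + 1) fun p hpm =>
      S.pz_dual_quotient (hp p 0 (by lia))
    have := h.projective_dual_pi n
    exact (S.dual ω).ssL₁ Z (m + 1) (ext_subsingleton_of_projective m)
      ((SES.of_submodule _).ssL₁ Z (m + 1 + 1) hK hQ)

lemma SerreS.pz_ext (hdim : ringKrullDim R = d)
    (hCM : ∀ j < d, Subsingleton (EE R (ResidueField R) R j)) {W : Type} [AddCommGroup W]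
    [Module R W] [Module.Finite R W] (hW : FID R W) {N : Type} [AddCommGroup N] [Module R N]
    [Module.Finite R N] {n : ℕ} (hN : SerreS R n N) (p : PrimeSpectrum R) (j : ℕ)
    (hj : hgt p ≤ j + n) : PZ p.asIdeal (EE R N W (j + 1)) :=
  LocReg.pz_ext (b := hgt p) (fun N _ _ _ j hj => hW.pz_ext hdim hCM p N j hj) (min n (hgt p)) N
    (hN.locReg hdim p (min_le_left _ _) (min_le_right _ _)) (j + 1) (by lia)

theorem Canon.ext_one_subsingleton (h : Canon R d ω) {Z : Type} [AddCommGroup Z] [Module R Z]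
    (hZ : IsMCM R d Z) {T : Type} [AddCommGroup T] [Module R T] [Module.Finite R T]
    (hT : SerreS R 2 T) (hW : FID R (T →ₗ[R] ω)) {n : ℕ} (hn : 3 ≤ n)
    (hTn : SerreS R n (T →ₗ[R] ω)) : Subsingleton (EE R T Z 1) := by
  have := h.finite
  have hTT : Subsingleton (EE R ((T →ₗ[R] ω) →ₗ[R] ω) Z (0 + 1)) :=
    h.ext_dual_subsingleton hZ d 0 hW
      (fun j hj => h.fid.ext_subsingleton_of_lt h.dim h.depth_ring _ j hj)
      fun p j hj => hTn.pz_ext h.dim h.depth_ring h.fid p j (by lia)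
  have hpz : ∀ p : PrimeSpectrum R, hgt p ≤ 2 → ∀ j, PZ p.asIdeal (EE R T ω (j + 1)) :=
    fun p hp j => hT.pz_ext h.dim h.depth_ring h.fid p j (by lia)
  have hker : Subsingleton (EE R (LinearMap.ker (deltaMap R ω T)) Z 1) :=
    ext_subsingleton_of_pz h.dim hZ fun p hp => h.pz_ker_delta p T (hpz p (by lia))
  have hcoker : Subsingleton (EE R (_ ⧸ LinearMap.range (deltaMap R ω T)) Z 2) :=
    ext_subsingleton_of_pz h.dim hZ fun p hp => h.pz_quotient_range_delta p T (hpz p hp)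
  have hrange := (SES.of_submodule (LinearMap.range (deltaMap R ω T))).ssL₁ Z 1 hTT hcoker
  rw [← ext_subsingleton_congr_left (deltaMap R ω T).quotKerEquivRange] at hrange
  exact (SES.of_submodule _).ssL₂ Z 1 hker hrange

lemma codGT.ext_subsingleton (hdim : ringKrullDim R = d) {Z : Type} [AddCommGroup Z] [Module R Z]
    (hZ : IsMCM R d Z) {N : Type} [AddCommGroup N] [Module R N] [Module.Finite R N] {n : ℕ}
    (hN : codGT R d N n) {j : ℕ} (hj : j ≤ n) : Subsingleton (EE R N Z j) := by
  have := hZ.1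
  refine ext_subsingleton_of_chgt hdim hZ.ext_subsingleton N j fun q hq => ?_
  have := chgt_add_lt_of_mdim hdim hN hq
  lia

omit [IsNoetherianRing R] in
lemma isSpecialCMPreenvelope_of_ext {N X : Type} [AddCommGroup N] [Module R N] [AddCommGroup X]
    [Module R X] (hX : IsMCM R d X) (μ : N →ₗ[R] X)
    (hker : ∀ (Z : Type) [AddCommGroup Z] [Module R Z], IsMCM R d Z →
      Subsingleton (EE R (LinearMap.ker μ) Z 0))
    (hcoker : ∀ (Z : Type) [AddCommGroup Z] [Module R Z], IsMCM R d Z →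
      Subsingleton (EE R (X ⧸ LinearMap.range μ) Z 1)) : IsSpecialCMPreenvelope R d μ := by
  refine ⟨⟨hX, fun Z _ _ hZ f => ?_⟩, fun Z _ _ hZ =>
    (subsingleton_ext1_iff R 1 _ Z).mpr (hcoker Z hZ)⟩
  have h1 := hker Z hZ
  have h2 := hcoker Z hZ
  have hle : LinearMap.ker μ ≤ LinearMap.ker f := by
    intro x hx
    have : f ∘ₗ (LinearMap.ker μ).subtype = 0 :=
      (homEquivExt _ Z).injective (Subsingleton.elim _ _)
    exact LinearMap.congr_fun this ⟨x, hx⟩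
  let φ : LinearMap.range μ →ₗ[R] Z :=
    (LinearMap.ker μ).liftQ f hle ∘ₗ μ.quotKerEquivRange.symm.toLinearMap
  obtain ⟨e, he⟩ := ((SES.of_submodule (LinearMap.range μ)).exactL₁ Z 0 (homEquivExt _ _ φ)).mp
    (Subsingleton.elim _ _)
  obtain ⟨g, rfl⟩ := (homEquivExt _ _).surjective e
  rw [extL_homEquivExt, (homEquivExt _ _).injective.eq_iff] at he
  refine ⟨g, LinearMap.ext fun x => ?_⟩
  exact (LinearMap.congr_fun he ⟨μ x, LinearMap.mem_range_self μ x⟩).trans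
    (congrArg ((LinearMap.ker μ).liftQ f hle) (μ.quotKerEquivRange_symm_apply_image x _))

theorem Canon.ext_one_subsingleton_of_exact (h : Canon R d ω) {Z : Type} [AddCommGroup Z]
    [Module R Z] (hZ : IsMCM R d Z) {S C T U : Type} [AddCommGroup S] [Module R S]
    [Module.Finite R S] [AddCommGroup C] [Module R C] [AddCommGroup T] [Module R T]
    [Module.Finite R T] [AddCommGroup U] [Module R U] [Module.Finite R U] {a : S →ₗ[R] C}
    {u : C →ₗ[R] T} {c : T →ₗ[R] U} (ha : Function.Injective a) (hau : Function.Exact a u)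
    (huc : Function.Exact u c) (hc : Function.Surjective c) {i : ℕ} (hS : codGT R d S (i + 1))
    (hU : codGT R d U (i + 2)) (hT : SerreS R 2 T) (hW : FID R (T →ₗ[R] ω))
    (hTi : SerreS R (i + 3) (T →ₗ[R] ω)) : Subsingleton (EE R C Z 1) := by
  have hI : Subsingleton (EE R (LinearMap.ker c) Z 1) :=
    (SES.of_surjective hc).ssL₁ Z 1 (h.ext_one_subsingleton hZ hT hW (by lia) hTi)
      (hU.ext_subsingleton h.dim hZ (by lia))
  have hu : SES a (u.codRestrict (LinearMap.ker c) huc.apply_apply_eq_zero) := by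
    refine ⟨ha, fun x => ?_, ?_⟩
    · rw [← hau x, ← Submodule.coe_eq_zero]
      rfl
    · rintro ⟨t, ht⟩
      obtain ⟨x, rfl⟩ := (huc t).mp ht
      exact ⟨x, rfl⟩
  exact hu.ssL₂ Z 1 (hS.ext_subsingleton h.dim hZ (by lia)) hI

end Main

/-- converse of Theorem 3: if a complex `0 → M → X⁰ → X¹ → ⋯` with each `X^i`
maximal Cohen-Macaulay satisfies, for each `i`, `cod (ker μ^i) > i` together with the existence
of an exact sequence `0 → S^i → coker μ^i → T^i → U^i → 0` with `cod S^i > i+1`,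
`cod U^i > i+2`, `T^i` satisfying `(S_2)`, and `(T^i)†` of finite injective dimension
satisfying `(S_{i+3})`, then the complex is a special proper CM-coresolution of `M`. -/
theorem special_proper_cm_coresolution_of_structure (R : Type) [CommRing R] [IsNoetherianRing R]
    [IsLocalRing R]
    (d : ℕ) (hdim : ringKrullDim R = d) (hCM : (d : ℕ∞) ≤ rdepth R R)
    (ω : Type) [AddCommGroup ω] [Module R ω] (hω : IsCanonicalModule R d ω)
    (M : Type) [AddCommGroup M] [Module R M] [Module.Finite R M]
    (X : ℕ → ModuleCat.{0} R)
    (d0 : M →ₗ[R] ↥(X 0)) (dn : ∀ i, ↥(X i) →ₗ[R] ↥(X (i+1)))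
    (hc0 : LinearMap.range d0 ≤ LinearMap.ker (dn 0))
    (hc : ∀ i, LinearMap.range (dn i) ≤ LinearMap.ker (dn (i+1)))
    (hMCM : ∀ i, IsMCM R d ↥(X i))
    (hstr : ∀ i : ℕ,
      codGT R d ↥(LinearMap.ker (muAt R M X d0 dn hc0 hc i)) i ∧
      ∃ (S T U : ModuleCat.{0} R)
          (a : ↥S →ₗ[R] (↥(X i) ⧸ LinearMap.range (muAt R M X d0 dn hc0 hc i)))
          (u : (↥(X i) ⧸ LinearMap.range (muAt R M X d0 dn hc0 hc i)) →ₗ[R] ↥T)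
          (c : ↥T →ₗ[R] ↥U),
        Module.Finite R ↥S ∧ Module.Finite R ↥T ∧ Module.Finite R ↥U ∧
        Function.Injective a ∧ Function.Exact a u ∧ Function.Exact u c ∧
        Function.Surjective c ∧
        codGT R d ↥S (i+1) ∧ codGT R d ↥U (i+2) ∧ SerreS R 2 ↥T ∧
        HasFID R (↥T →ₗ[R] ω) ∧ SerreS R (i+3) (↥T →ₗ[R] ω)) :
    IsSpecialProperCMCoresolution R M X d0 dn hc0 hc d := by
  have h := hω.canon hdim hCM
  have hfin : ∀ i, Module.Finite R (cokerAt R M X d0 dn i)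
    | 0 => inferInstanceAs (Module.Finite R M)
    | 1 => have := (hMCM 0).1; inferInstanceAs (Module.Finite R (X 0 ⧸ LinearMap.range d0))
    | i + 2 => have := (hMCM (i + 1)).1
      inferInstanceAs (Module.Finite R (X (i + 1) ⧸ LinearMap.range (dn i)))
  refine ⟨hMCM, fun i => ?_⟩
  obtain ⟨hk, S, T, U, a, u, c, hS, hT, hU, ha, hau, huc, hc, hSc, hUc, hT2, hW, hTi⟩ := hstr i
  have := hfin i
  exact isSpecialCMPreenvelope_of_ext (hMCM i) _
    (fun Z _ _ hZ => hk.ext_subsingleton hdim hZ (Nat.zero_le i))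
    fun Z _ _ hZ => h.ext_one_subsingleton_of_exact hZ ha hau huc hc hSc hUc hT2 hW.fid hTi
end

section
/- If μ : M → X is a special CM-preenvelope of the finitely generated R-module M (so X is maximal Cohen–Macaulay), then the dual map μ† : X† → M† is a special CM-precover of M†. -/
open CategoryTheory

section Comparison

variable {A : Type} [CommRing A]

theorem subsingleton_ext_iff_forall_cocycle {M N : ModuleCat.{0} A} (P : ProjectiveResolution M)
    (n : ℕ) :
    Subsingleton (Abelian.Ext M N (n + 1)) ↔
      ∀ f : P.complex.X (n + 1) ⟶ N, P.complex.d (n + 2) (n + 1) ≫ f = 0 →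
        ∃ g : P.complex.X n ⟶ N, P.complex.d (n + 1) n ≫ g = f := by
  refine ⟨fun _ f hf ↦ (P.extMk_eq_zero_iff f (n + 2) rfl hf n rfl).1 (Subsingleton.elim _ _),
    fun H ↦ subsingleton_of_forall_eq 0 fun α ↦ ?_⟩
  obtain ⟨f, hf, rfl⟩ := P.extMk_surjective α (n + 2) rfl
  exact (P.extMk_eq_zero_iff f (n + 2) rfl hf n rfl).2 (H f hf)

theorem subsingleton_ext_zero_iff_forall_cocycle {M N : ModuleCat.{0} A}
    (P : ProjectiveResolution M) :
    Subsingleton (Abelian.Ext M N 0) ↔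
      ∀ f : P.complex.X 0 ⟶ N, P.complex.d 1 0 ≫ f = 0 → f = 0 := by
  refine ⟨fun _ f hf ↦ ?_, fun H ↦ subsingleton_of_forall_eq 0 fun α ↦ ?_⟩
  · have : Subsingleton (M ⟶ N) := Abelian.Ext.addEquiv₀.symm.subsingleton
    obtain ⟨g, hg⟩ := Limits.CokernelCofork.IsColimit.desc' P.exact₀.gIsCokernel f hf
    have hg0 : g = 0 := Subsingleton.elim (α := M ⟶ N) g 0
    rw [← hg, hg0, Limits.comp_zero]
  · obtain ⟨f, hf, rfl⟩ := P.extMk_surjective α 1 rfl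
    simp [H f hf]

/-- The two definitions of `Ext` in Mathlib, by the derived functors and by the derived category,
vanish simultaneously. -/
theorem subsingleton_ext1_iff_subsingleton_ext (n : ℕ) (M N : Type) [AddCommGroup M] [Module A M]
    [AddCommGroup N] [Module A N] :
    Subsingleton (ext1 A n M N) ↔
      Subsingleton (Abelian.Ext (ModuleCat.of A M) (ModuleCat.of A N) n) := by
  let P := projectiveResolution (ModuleCat.of A M)
  have e := P.isoExt (R := A) n (ModuleCat.of A N)
  have h : Subsingleton (ext1 A n M N) ↔
      (P.complex.linearYonedaObj A (ModuleCat.of A N)).ExactAt n := by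
    rw [HomologicalComplex.exactAt_iff_isZero_homology, ← e.isZero_iff,
      ModuleCat.isZero_iff_subsingleton]
    rfl
  rw [h]
  cases n with
  | zero =>
    rw [subsingleton_ext_zero_iff_forall_cocycle P,
      HomologicalComplex.exactAt_iff' _ 0 0 1 (by simp) (by simp),
      ShortComplex.moduleCat_exact_iff]
    refine ⟨fun H f hf ↦ ?_, fun H f hf ↦ ⟨0, ?_⟩⟩
    · obtain ⟨g, hg⟩ := H f hf
      have := (P.complex.linearYonedaObj A (ModuleCat.of A N)).shape 0 0 (by simp)
      rw [← hg]
      exact congrArg (fun φ ↦ φ.hom g) this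
    · exact (H f hf).symm
  | succ n =>
    rw [subsingleton_ext_iff_forall_cocycle P,
      HomologicalComplex.exactAt_iff' _ n (n + 1) (n + 2) (by simp) (by simp),
      ShortComplex.moduleCat_exact_iff]
    exact Iff.rfl

end Comparison

section ExactSequences

variable {A : Type} [CommRing A]

theorem subsingleton_ext_of_shortExact_middle {S : ShortComplex (ModuleCat.{0} A)}
    (hS : S.ShortExact) (W : ModuleCat.{0} A) (n : ℕ) (h₁ : Subsingleton (Abelian.Ext S.X₁ W n))
    (h₃ : Subsingleton (Abelian.Ext S.X₃ W n)) : Subsingleton (Abelian.Ext S.X₂ W n) := by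
  refine subsingleton_of_forall_eq 0 fun x ↦ ?_
  obtain ⟨y, rfl⟩ := Abelian.Ext.contravariant_sequence_exact₂ hS W x (Subsingleton.elim _ _)
  rw [Subsingleton.elim y 0, Abelian.Ext.comp_zero]

theorem subsingleton_ext_of_shortExact_left {S : ShortComplex (ModuleCat.{0} A)}
    (hS : S.ShortExact) (W : ModuleCat.{0} A) (n : ℕ) (h₂ : Subsingleton (Abelian.Ext S.X₂ W n))
    (h₃ : Subsingleton (Abelian.Ext S.X₃ W (n + 1))) : Subsingleton (Abelian.Ext S.X₁ W n) := by
  refine subsingleton_of_forall_eq 0 fun x ↦ ?_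
  obtain ⟨y, rfl⟩ := Abelian.Ext.contravariant_sequence_exact₁ hS W x (add_comm 1 n)
    (Subsingleton.elim _ _)
  rw [Subsingleton.elim y 0, Abelian.Ext.comp_zero]

theorem subsingleton_ext_of_shortExact_right {S : ShortComplex (ModuleCat.{0} A)}
    (hS : S.ShortExact) (W : ModuleCat.{0} A) (n : ℕ) (h₁ : Subsingleton (Abelian.Ext S.X₁ W n))
    (h₂ : Subsingleton (Abelian.Ext S.X₂ W (n + 1))) :
    Subsingleton (Abelian.Ext S.X₃ W (n + 1)) := by
  refine subsingleton_of_forall_eq 0 fun x ↦ ?_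
  obtain ⟨y, rfl⟩ := Abelian.Ext.contravariant_sequence_exact₃ hS W x
    (Subsingleton.elim _ _) (add_comm 1 n)
  rw [Subsingleton.elim y 0, Abelian.Ext.comp_zero]

theorem subsingleton_ext_covariant_of_shortExact_right {S : ShortComplex (ModuleCat.{0} A)}
    (hS : S.ShortExact) (K : ModuleCat.{0} A) (n : ℕ) (h₂ : Subsingleton (Abelian.Ext K S.X₂ n))
    (h₁ : Subsingleton (Abelian.Ext K S.X₁ (n + 1))) : Subsingleton (Abelian.Ext K S.X₃ n) := by
  refine subsingleton_of_forall_eq 0 fun x ↦ ?_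
  obtain ⟨y, rfl⟩ := Abelian.Ext.covariant_sequence_exact₃ K hS x rfl (Subsingleton.elim _ _)
  rw [Subsingleton.elim y 0, Abelian.Ext.zero_comp]

theorem subsingleton_ext_covariant_of_shortExact_left {S : ShortComplex (ModuleCat.{0} A)}
    (hS : S.ShortExact) (K : ModuleCat.{0} A) (n : ℕ) (h₃ : Subsingleton (Abelian.Ext K S.X₃ n))
    (h₂ : Subsingleton (Abelian.Ext K S.X₂ (n + 1))) :
    Subsingleton (Abelian.Ext K S.X₁ (n + 1)) := by
  refine subsingleton_of_forall_eq 0 fun x ↦ ?_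
  obtain ⟨y, rfl⟩ := Abelian.Ext.covariant_sequence_exact₁ K hS x (Subsingleton.elim _ _) rfl
  rw [Subsingleton.elim y 0, Abelian.Ext.zero_comp]

theorem subsingleton_ext_zero_of_mono {M N : ModuleCat.{0} A} (f : M ⟶ N) [Mono f]
    (K : ModuleCat.{0} A) (h : Subsingleton (Abelian.Ext K N 0)) :
    Subsingleton (Abelian.Ext K M 0) :=
  (Abelian.Ext.postcomp_mk₀_injective_of_mono K f).subsingleton

/-- If `Ext¹(X₃, W) = 0`, then every morphism `X₁ ⟶ W` extends to `X₂`. -/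
theorem exists_extension_of_subsingleton_ext {S : ShortComplex (ModuleCat.{0} A)}
    (hS : S.ShortExact) (W : ModuleCat.{0} A) (h : Subsingleton (Abelian.Ext S.X₃ W 1))
    (f : S.X₁ ⟶ W) : ∃ g : S.X₂ ⟶ W, S.f ≫ g = f := by
  obtain ⟨y, hy⟩ := Abelian.Ext.contravariant_sequence_exact₁ hS W (Abelian.Ext.mk₀ f)
    (add_zero 1) (Subsingleton.elim _ _)
  obtain ⟨g, rfl⟩ := Abelian.Ext.mk₀_bijective _ _ |>.2 y
  refine ⟨g, (Abelian.Ext.mk₀_bijective _ _).1 ?_⟩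
  rw [← hy, Abelian.Ext.mk₀_comp_mk₀]

/-- If `Ext¹(K, X₁) = 0`, then every morphism `K ⟶ X₃` lifts to `X₂`. -/
theorem exists_lift_of_subsingleton_ext {S : ShortComplex (ModuleCat.{0} A)}
    (hS : S.ShortExact) (K : ModuleCat.{0} A) (h : Subsingleton (Abelian.Ext K S.X₁ 1))
    (f : K ⟶ S.X₃) : ∃ g : K ⟶ S.X₂, g ≫ S.g = f := by
  obtain ⟨y, hy⟩ := Abelian.Ext.covariant_sequence_exact₃ K hS (Abelian.Ext.mk₀ f)
    (zero_add 1) (Subsingleton.elim _ _)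
  obtain ⟨g, rfl⟩ := Abelian.Ext.mk₀_bijective _ _ |>.2 y
  refine ⟨g, (Abelian.Ext.mk₀_bijective _ _).1 ?_⟩
  rw [← hy, Abelian.Ext.mk₀_comp_mk₀]

/-- If `X₂` is projective and every morphism `X₁ ⟶ W` extends to `X₂`,
then `Ext¹(X₃, W) = 0`. -/
theorem subsingleton_ext_one_of_exists_extension {S : ShortComplex (ModuleCat.{0} A)}
    (hS : S.ShortExact) [Projective S.X₂] (W : ModuleCat.{0} A)
    (h : ∀ f : S.X₁ ⟶ W, ∃ g : S.X₂ ⟶ W, S.f ≫ g = f) :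
    Subsingleton (Abelian.Ext S.X₃ W 1) := by
  refine subsingleton_of_forall_eq 0 fun x ↦ ?_
  obtain ⟨y, rfl⟩ := Abelian.Ext.contravariant_sequence_exact₃ hS W x
    (Abelian.Ext.eq_zero_of_projective _) (add_zero 1)
  obtain ⟨f, rfl⟩ := Abelian.Ext.mk₀_bijective _ _ |>.2 y
  obtain ⟨g, rfl⟩ := h f
  rw [← Abelian.Ext.mk₀_comp_mk₀]
  exact hS.extClass_comp_assoc _

end ExactSequences

section Depth

variable {R : Type} [CommRing R] [IsNoetherianRing R]

theorem subsingleton_ext_of_subsingleton_ext_quotSMulTop [IsLocalRing R] {N W : ModuleCat.{0} R}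
    [Module.Finite R N] [Module.Finite R W] {x : R} (hx : x ∈ IsLocalRing.maximalIdeal R)
    (reg : IsSMulRegular N x) (n : ℕ)
    (h : Subsingleton (Abelian.Ext (ModuleCat.of R (QuotSMulTop x N)) W (n + 1))) :
    Subsingleton (Abelian.Ext N W n) := by
  have key : (⊤ : Submodule R (Abelian.Ext N W n)) ≤ IsLocalRing.maximalIdeal R • ⊤ := by
    intro α _
    obtain ⟨(β : Abelian.Ext N W n), hβ⟩ := Abelian.Ext.contravariant_sequence_exact₁
      reg.smulShortComplex_shortExact W α (add_comm 1 n)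
      (Subsingleton.elim (α := Abelian.Ext (ModuleCat.of R (QuotSMulTop x N)) W (n + 1)) _ _)
    replace hβ : (Abelian.Ext.mk₀ (x • 𝟙 N)).comp β (zero_add n) = α := hβ
    rw [← hβ, Abelian.Ext.mk₀_smul, Abelian.Ext.smul_comp, Abelian.Ext.mk₀_id_comp]
    exact Submodule.smul_mem_smul hx trivial
  have := Submodule.eq_bot_of_le_smul_of_le_jacobson_bot _ _ Module.Finite.fg_top key
    (IsLocalRing.maximalIdeal_le_jacobson _)
  exact (Submodule.subsingleton_iff R).1 (subsingleton_of_bot_eq_top this.symm)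

theorem exists_isSMulRegular_of_subsingleton_ext_residueField [IsLocalRing R] {N : ModuleCat.{0} R}
    [Module.Finite R N] {t : ℕ} (h : ∀ i < t + 1,
      Subsingleton (Abelian.Ext (ModuleCat.of R (IsLocalRing.ResidueField R)) N i)) :
    ∃ x ∈ IsLocalRing.maximalIdeal R, IsSMulRegular N x ∧ ∀ i < t,
      Subsingleton (Abelian.Ext (ModuleCat.of R (IsLocalRing.ResidueField R))
        (ModuleCat.of R (QuotSMulTop x N)) i) := by
  have : Subsingleton (ModuleCat.of R (IsLocalRing.ResidueField R) ⟶ N) :=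
    Abelian.Ext.addEquiv₀.subsingleton_congr.mp (h 0 t.zero_lt_succ)
  have : Subsingleton (IsLocalRing.ResidueField R →ₗ[R] N) :=
    (ModuleCat.homAddEquiv (M := ModuleCat.of R (IsLocalRing.ResidueField R))).symm.subsingleton
  obtain ⟨x, hx, reg⟩ := IsSMulRegular.subsingleton_linearMap_iff.mp this
  have hann : Module.annihilator R (IsLocalRing.ResidueField R) = IsLocalRing.maximalIdeal R :=
    Ideal.annihilator_quotient
  exact ⟨x, hann ▸ hx, reg, fun i hi ↦ subsingleton_ext_covariant_of_shortExact_right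
    reg.smulShortComplex_shortExact _ i (h i (by lia)) (h (i + 1) (by lia))⟩

/-- If `W` has injective dimension at most `r` and `N` has depth at least `t`, then
`Ext^n(N, W) = 0` for `n > r - t`. -/
theorem subsingleton_ext_of_depth [IsLocalRing R] {W : ModuleCat.{0} R} [Module.Finite R W] {r : ℕ}
    (hr : ∀ (N : ModuleCat.{0} R) [Module.Finite R N], ∀ n > r, Subsingleton (Abelian.Ext N W n))
    (t : ℕ) (N : ModuleCat.{0} R) [Module.Finite R N]
    (h : ∀ i < t, Subsingleton (Abelian.Ext (ModuleCat.of R (IsLocalRing.ResidueField R)) N i))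
    (n : ℕ) (hn : r < n + t) : Subsingleton (Abelian.Ext N W n) := by
  induction t generalizing N n with
  | zero => exact hr N n hn
  | succ t ih =>
    obtain ⟨x, hx, reg, h'⟩ := exists_isSMulRegular_of_subsingleton_ext_residueField h
    exact subsingleton_ext_of_subsingleton_ext_quotSMulTop hx reg n
      (ih (ModuleCat.of R (QuotSMulTop x N)) h' (n + 1) (by lia))

/-- The quotients of a local ring by regular sequences: modules of projective dimension at most `t`,
of dimension `d - t` and of depth at least `d - t`. -/
theorem exists_module_quotient_regular [IsLocalRing R] {d : ℕ} (hdim : ringKrullDim R = d)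
    (hR : ∀ i < d, Subsingleton (Abelian.Ext (ModuleCat.of R (IsLocalRing.ResidueField R))
      (ModuleCat.of R R) i)) (t : ℕ) (ht : t ≤ d) :
    ∃ N : ModuleCat.{0} R, Module.Finite R N ∧ Module.supportDim R N + t = d ∧
      (∀ i, i + t < d →
        Subsingleton (Abelian.Ext (ModuleCat.of R (IsLocalRing.ResidueField R)) N i)) ∧
      ∀ (W : ModuleCat.{0} R), ∀ n > t, Subsingleton (Abelian.Ext N W n) := by
  induction t with
  | zero =>
    refine ⟨ModuleCat.of R R, inferInstanceAs (Module.Finite R R), ?_, fun i hi ↦ hR i hi, ?_⟩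
    · simp [Module.supportDim_self_eq_ringKrullDim, hdim]
    · rintro W (_ | n) hn
      · lia
      · have : Projective (ModuleCat.of R R) :=
          (IsProjective.iff_projective R).1 inferInstance
        exact Abelian.Ext.subsingleton_of_projective _ _ _
  | succ t ih =>
    obtain ⟨N, _, hN, hk, hW⟩ := ih (by lia)
    obtain ⟨x, hx, reg, h'⟩ := exists_isSMulRegular_of_subsingleton_ext_residueField
      (N := N) (t := d - (t + 1)) (fun i hi ↦ hk i (by lia))
    refine ⟨ModuleCat.of R (QuotSMulTop x N), inferInstanceAs (Module.Finite R (QuotSMulTop x N)),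
      ?_, fun i hi ↦ h' i (by lia), ?_⟩
    · rw [← hN, ← Module.supportDim_quotSMulTop_succ_eq_supportDim reg hx]
      push_cast
      rw [add_assoc, add_comm (1 : WithBot ℕ∞)]
    · rintro W (_ | n) hn
      · lia
      · exact subsingleton_ext_of_shortExact_right reg.smulShortComplex_shortExact W n
          (hW W n (by lia)) (hW W (n + 1) (by lia))

end Depth

section InjectiveDimension

variable {R : Type} [CommRing R] [IsNoetherianRing R] [IsLocalRing R]

theorem exists_injective_residueField_of_supportDim_eq_zero {N : Type} [AddCommGroup N] [Module R N]
    (h : Module.supportDim R N = 0) :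
    ∃ f : (R ⧸ IsLocalRing.maximalIdeal R) →ₗ[R] N, Function.Injective f := by
  have : Nontrivial N := by simp [← Module.supportDim_ne_bot_iff_nontrivial R, h]
  obtain ⟨p, hp⟩ := associatedPrimes.nonempty R N
  obtain ⟨hprime, f, hf⟩ := (isAssociatedPrime_iff_exists_injective_linearMap _ _).1 hp
  have hsupp : (⟨p, hprime⟩ : PrimeSpectrum R) ∈ Module.support R N :=
    Module.support_subset_of_injective f hf <| by
      simp [Module.support_eq_zeroLocus, Ideal.annihilator_quotient]
  rw [support_of_supportDim_eq_zero R N h, PrimeSpectrum.mem_zeroLocus] at hsupp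
  obtain rfl : p = IsLocalRing.maximalIdeal R :=
    (IsLocalRing.le_maximalIdeal hprime.ne_top).antisymm hsupp
  exact ⟨f, hf⟩

theorem subsingleton_ext_of_forall_succ {d : ℕ} (hdim : ringKrullDim R = d)
    (hR : ∀ i < d, Subsingleton (Abelian.Ext (ModuleCat.of R (IsLocalRing.ResidueField R))
      (ModuleCat.of R R) i)) {W : ModuleCat.{0} R} [Module.Finite R W] {n : ℕ} (hn : d < n)
    (h : ∀ (N : ModuleCat.{0} R) [Module.Finite R N], Subsingleton (Abelian.Ext N W (n + 1)))
    (N : ModuleCat.{0} R) [hN : Module.Finite R N] : Subsingleton (Abelian.Ext N W n) := by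
  obtain ⟨T, _, hT, -, hTW⟩ := exists_module_quotient_regular hdim hR d le_rfl
  have hT0 : Module.supportDim R T = 0 := by
    generalize Module.supportDim R T = a at hT
    induction a with
    | bot => simp at hT
    | coe a =>
      induction a with
      | top => norm_cast at hT
      | coe a => norm_cast at hT ⊢; lia
  obtain ⟨f, hf⟩ := exists_injective_residueField_of_supportDim_eq_zero hT0
  suffices H : ∀ (N : Type) [AddCommGroup N] [Module R N] (_ : Module.Finite R N),
    Subsingleton (Abelian.Ext (ModuleCat.of R N) W n) from H N hN
  intro N _ _ hN
  induction hN using IsNoetherianRing.induction_on_isQuotientEquivQuotientPrime R with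
  | subsingleton N =>
    obtain ⟨n, rfl⟩ := Nat.exists_eq_succ_of_ne_zero (Nat.ne_zero_of_lt hn)
    have : Projective (ModuleCat.of R N) := (IsProjective.iff_projective N).1 inferInstance
    exact Abelian.Ext.subsingleton_of_projective _ _ _
  | quotient N p e =>
    by_cases hp : p.1 = IsLocalRing.maximalIdeal R
    · rw [hp] at e
      let g : N →ₗ[R] T := f ∘ₗ e.toLinearMap
      have hg : Function.Injective g := hf.comp e.injective
      let S : ShortComplex (ModuleCat.{0} R) := ShortComplex.mk (ModuleCat.ofHom g)
        (ModuleCat.ofHom (LinearMap.range g).mkQ) (by ext x; simp)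
      have hS : S.ShortExact :=
        { exact := (ShortComplex.ShortExact.moduleCat_exact_iff_function_exact _).2
            (LinearMap.exact_map_mkQ_range g)
          mono_f := (ModuleCat.mono_iff_injective _).2 hg
          epi_g := (ModuleCat.epi_iff_surjective _).2 (Submodule.mkQ_surjective _) }
      exact subsingleton_ext_of_shortExact_left hS W n (hTW W n hn)
        (h (ModuleCat.of R (T ⧸ LinearMap.range g)))
    · obtain ⟨x, hx, hxp⟩ := Set.not_subset.1 fun hle ↦
        hp ((IsLocalRing.le_maximalIdeal p.2.ne_top).antisymm hle)
      have reg : IsSMulRegular N x := by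
        refine (e.isSMulRegular_congr x).2 (isSMulRegular_iff_right_eq_zero_of_smul.2 fun y hy ↦ ?_)
        obtain ⟨y, rfl⟩ := Ideal.Quotient.mk_surjective y
        rw [Ideal.Quotient.eq_zero_iff_mem]
        exact (p.2.mem_or_mem (Ideal.Quotient.eq_zero_iff_mem.1 hy)).resolve_left hxp
      exact subsingleton_ext_of_subsingleton_ext_quotSMulTop (N := ModuleCat.of R N) hx reg n
        (h (ModuleCat.of R (QuotSMulTop x N)))
  | exact N₁ N₂ N₃ f g hf hg hfg h₁ h₃ =>
    let S : ShortComplex (ModuleCat.{0} R) := ShortComplex.mk (ModuleCat.ofHom f)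
      (ModuleCat.ofHom g) (by ext x; exact hfg.apply_apply_eq_zero x)
    have hS : S.ShortExact :=
      { exact := (ShortComplex.ShortExact.moduleCat_exact_iff_function_exact _).2 hfg
        mono_f := (ModuleCat.mono_iff_injective _).2 hf
        epi_g := (ModuleCat.epi_iff_surjective _).2 hg }
    exact subsingleton_ext_of_shortExact_middle hS W n h₁ h₃

/-- Over a Cohen-Macaulay local ring of dimension `d`, a finitely generated module of finite
injective dimension has injective dimension at most `d`. -/
theorem subsingleton_ext_of_injectiveDimension_lt_top {d : ℕ} (hdim : ringKrullDim R = d)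
    (hR : ∀ i < d, Subsingleton (Abelian.Ext (ModuleCat.of R (IsLocalRing.ResidueField R))
      (ModuleCat.of R R) i)) {W : ModuleCat.{0} R} [Module.Finite R W] {r : ℕ}
    (hr : ∀ (N : ModuleCat.{0} R) [Module.Finite R N], ∀ n > r, Subsingleton (Abelian.Ext N W n))
    (N : ModuleCat.{0} R) [Module.Finite R N] (n : ℕ) (hn : d < n) :
    Subsingleton (Abelian.Ext N W n) := by
  suffices H : ∀ (j n : ℕ), d < n → r < n + j → ∀ (N : ModuleCat.{0} R) [Module.Finite R N],
    Subsingleton (Abelian.Ext N W n) from H (r + 1) n hn (by lia) N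
  intro j
  induction j with
  | zero => exact fun n _ hn N _ ↦ hr N n hn
  | succ j ih =>
    exact fun n hdn hn N _ ↦ subsingleton_ext_of_forall_succ hdim hR hdn
      (fun N _ ↦ ih (n + 1) (by lia) (by lia) N) N

end InjectiveDimension

section Dual

variable {R : Type} [CommRing R] (W : Type) [AddCommGroup W] [Module R W]

/-- The dual `0 → Hom(N, W) → Hom(F, W) → Hom(ker p, W)` of the presentation of a module `N`
by a linear map `p : F → N`. -/
abbrev dualShortComplex {F N : Type} [AddCommGroup F] [Module R F] [AddCommGroup N] [Module R N]
    (p : F →ₗ[R] N) : ShortComplex (ModuleCat.{0} R) :=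
  ShortComplex.mk (ModuleCat.ofHom (LinearMap.lcomp R W p))
    (ModuleCat.ofHom (LinearMap.lcomp R W (LinearMap.ker p).subtype)) (by ext f x; simp)

theorem dualShortComplex_shortExact {F N : Type} [AddCommGroup F] [Module R F] [AddCommGroup N]
    [Module R N] {p : F →ₗ[R] N} (hp : Function.Surjective p)
    (h : Subsingleton (Abelian.Ext (ModuleCat.of R N) (ModuleCat.of R W) 1)) :
    (dualShortComplex W p).ShortExact where
  exact := by
    refine (ShortComplex.ShortExact.moduleCat_exact_iff_function_exact _).2
      fun f ↦ ⟨fun hf ↦ ?_, ?_⟩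
    · have hker : LinearMap.ker p ≤ LinearMap.ker f := fun x hx ↦
        LinearMap.congr_fun (f := f ∘ₗ (LinearMap.ker p).subtype) hf ⟨x, hx⟩
      exact ⟨((LinearMap.ker p).liftQ f hker) ∘ₗ (p.quotKerEquivOfSurjective hp).symm.toLinearMap,
        by
          ext x
          change (LinearMap.ker p).liftQ f hker ((p.quotKerEquivOfSurjective hp).symm (p x)) = f x
          rw [(p.quotKerEquivOfSurjective hp).symm_apply_eq.2
            (p.quotKerEquivOfSurjective_apply_mk hp x).symm]
          rfl⟩
    · rintro ⟨g, rfl⟩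
      ext x
      simp
  mono_f := (ModuleCat.mono_iff_injective _).2 fun f g hfg ↦ LinearMap.cancel_right hp |>.1 hfg
  epi_g := (ModuleCat.epi_iff_surjective _).2 fun f ↦ by
    obtain ⟨g, hg⟩ := exists_extension_of_subsingleton_ext
      (LinearMap.shortExact_shortComplexKer hp) (ModuleCat.of R W) h (ModuleCat.ofHom f)
    exact ⟨g.hom, congrArg ModuleCat.Hom.hom hg⟩

theorem subsingleton_ext_dual_pi (K : ModuleCat.{0} R) (m n : ℕ)
    (h : Subsingleton (Abelian.Ext K (ModuleCat.of R W) m)) :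
    Subsingleton (Abelian.Ext K (ModuleCat.of R ((Fin n → R) →ₗ[R] W)) m) := by
  let D := ModuleCat.of R ((Fin n → R) →ₗ[R] W)
  let π (i : Fin n) : D ⟶ ModuleCat.of R W :=
    ModuleCat.ofHom (LinearMap.applyₗ (Pi.single i 1))
  let ι (i : Fin n) : ModuleCat.of R W ⟶ D :=
    ModuleCat.ofHom (LinearMap.lcomp R W (LinearMap.proj i) ∘ₗ
      (LinearMap.ringLmapEquivSelf R R W).symm.toLinearMap)
  have hid : 𝟙 D = ∑ i, π i ≫ ι i := by
    ext f i
    simp [π, ι, D, Pi.single_apply]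
  refine subsingleton_of_forall_eq 0 fun (α : Abelian.Ext K D m) ↦ ?_
  rw [← α.comp_mk₀_id, hid, Abelian.Ext.mk₀_sum, Abelian.Ext.comp_sum]
  refine Finset.sum_eq_zero fun i _ ↦ ?_
  rw [← Abelian.Ext.mk₀_comp_mk₀, ← Abelian.Ext.comp_assoc_of_third_deg_zero,
    Subsingleton.elim (α.comp (Abelian.Ext.mk₀ (π i)) (add_zero m)) 0, Abelian.Ext.zero_comp]

/-- If `Ext^i(K, W) = 0` for `i < d` and `Ext^i(N, W) = 0` for `i > 0`, then
`Ext^i(K, Hom(N, W)) = 0` for `i < d`. -/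
theorem subsingleton_ext_dual [IsNoetherianRing R] (K : ModuleCat.{0} R) {d : ℕ}
    (hW : ∀ i < d, Subsingleton (Abelian.Ext K (ModuleCat.of R W) i))
    (N : Type) [AddCommGroup N] [Module R N] [Module.Finite R N]
    (hN : ∀ i, Subsingleton (Abelian.Ext (ModuleCat.of R N) (ModuleCat.of R W) (i + 1)))
    (m : ℕ) (hm : m < d) : Subsingleton (Abelian.Ext K (ModuleCat.of R (N →ₗ[R] W)) m) := by
  obtain ⟨n, p, hp⟩ := Module.Finite.exists_fin' R N
  have hS := dualShortComplex_shortExact W hp (hN 0)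
  induction m generalizing N n with
  | zero =>
    have := hS.mono_f
    exact subsingleton_ext_zero_of_mono (dualShortComplex W p).f K
      (subsingleton_ext_dual_pi W K 0 n (hW 0 hm))
  | succ m ih =>
    have hF : Projective (ModuleCat.of R (Fin n → R)) :=
      (IsProjective.iff_projective _).1 inferInstance
    have hΩ (i : ℕ) : Subsingleton
        (Abelian.Ext (ModuleCat.of R (LinearMap.ker p)) (ModuleCat.of R W) (i + 1)) :=
      subsingleton_ext_of_shortExact_left (LinearMap.shortExact_shortComplexKer hp) _ _
        (Abelian.Ext.subsingleton_of_projective _ _ _) (hN (i + 1))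
    obtain ⟨n', p', hp'⟩ := Module.Finite.exists_fin' R (LinearMap.ker p)
    exact subsingleton_ext_covariant_of_shortExact_left hS K m
      (ih (LinearMap.ker p) hΩ (by lia) n' p' hp' (dualShortComplex_shortExact W hp' (hΩ 0)))
      (subsingleton_ext_dual_pi W K (m + 1) n (hW (m + 1) hm))

end Dual

section CohenMacaulay

variable {R : Type} [CommRing R]

theorem le_rdepth_iff [IsLocalRing R] (d : ℕ) (M : Type) [AddCommGroup M] [Module R M] :
    (d : ℕ∞) ≤ rdepth R M ↔ ∀ i < d, Subsingleton
      (Abelian.Ext (ModuleCat.of R (IsLocalRing.ResidueField R)) (ModuleCat.of R M) i) := by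
  simp only [rdepth, le_sInf_iff, Set.mem_ofPred_eq, ← subsingleton_ext1_iff_subsingleton_ext]
  refine ⟨fun h i hi ↦ ?_, ?_⟩
  · by_contra hn
    exact absurd (Nat.cast_le.1 (h i ⟨i, rfl, hn⟩)) (by lia)
  · rintro h _ ⟨m, rfl, hm⟩
    by_contra hlt
    exact hm (h m (Nat.cast_lt.1 (not_le.1 hlt)))

theorem subsingleton_ext_ker_dmap (W : Type) [AddCommGroup W] [Module R W] {M X : Type}
    [AddCommGroup M] [Module R M] [AddCommGroup X] [Module R X] (μ : M →ₗ[R] X) (Z : Type)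
    [AddCommGroup Z] [Module R Z] [Module.Finite R Z]
    (hZ : Subsingleton (Abelian.Ext (ModuleCat.of R Z) (ModuleCat.of R W) 1))
    (h : Subsingleton (Abelian.Ext (ModuleCat.of R (X ⧸ LinearMap.range μ))
      (ModuleCat.of R (Z →ₗ[R] W)) 1)) :
    Subsingleton (Abelian.Ext (ModuleCat.of R Z)
      (ModuleCat.of R (LinearMap.ker (dmap R W μ))) 1) := by
  obtain ⟨n, p, hp⟩ := Module.Finite.exists_fin' R Z
  have : Projective (ModuleCat.of R (Fin n → R)) :=
    (IsProjective.iff_projective _).1 inferInstance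
  refine subsingleton_ext_one_of_exists_extension (LinearMap.shortExact_shortComplexKer hp) _
    fun f ↦ ?_
  let f' : LinearMap.ker p →ₗ[R] LinearMap.ker (dmap R W μ) := f.hom
  let φ : (X ⧸ LinearMap.range μ) →ₗ[R] LinearMap.ker p →ₗ[R] W :=
    (LinearMap.range μ).liftQ ((LinearMap.ker (dmap R W μ)).subtype ∘ₗ f').flip <| by
      rintro _ ⟨x, rfl⟩
      ext y
      exact LinearMap.congr_fun (LinearMap.mem_ker.1 (f' y).2) x
  obtain ⟨ψ, hψ⟩ := exists_lift_of_subsingleton_ext (dualShortComplex_shortExact W hp hZ)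
    (ModuleCat.of R (X ⧸ LinearMap.range μ)) h (ModuleCat.ofHom φ)
  let ψ' : (X ⧸ LinearMap.range μ) →ₗ[R] (Fin n → R) →ₗ[R] W := ψ.hom
  have hψ' (x : X) (y : LinearMap.ker p) : ψ' (Submodule.Quotient.mk x) y = (f' y).1 x :=
    LinearMap.congr_fun (LinearMap.congr_fun (congrArg ModuleCat.Hom.hom hψ)
      (Submodule.Quotient.mk x)) y
  let g : (Fin n → R) →ₗ[R] LinearMap.ker (dmap R W μ) :=
    LinearMap.codRestrict _ (ψ' ∘ₗ (LinearMap.range μ).mkQ).flip fun y ↦ by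
      rw [LinearMap.mem_ker]
      ext x
      simp [dmap, (Submodule.Quotient.mk_eq_zero (LinearMap.range μ)).2 ⟨x, rfl⟩]
  refine ⟨ModuleCat.ofHom g, ?_⟩
  refine ModuleCat.hom_ext (LinearMap.ext fun y ↦ ?_)
  change g (y : LinearMap.ker p) = f' y
  exact Subtype.ext (LinearMap.ext fun x ↦ hψ' x y)

theorem IsMCM.subsingleton_ext [IsNoetherianRing R] [IsLocalRing R] {d : ℕ}
    (hdim : ringKrullDim R = d) (hCM : (d : ℕ∞) ≤ rdepth R R) {ω : Type} [AddCommGroup ω]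
    [Module R ω] (hω : IsCanonicalModule R d ω) {Z : Type} [AddCommGroup Z] [Module R Z]
    (hZ : IsMCM R d Z) (i : ℕ) :
    Subsingleton (Abelian.Ext (ModuleCat.of R Z) (ModuleCat.of R ω) (i + 1)) := by
  have : Module.Finite R ω := hω.1.1
  have : Module.Finite R Z := hZ.1
  obtain ⟨r, hr⟩ := hω.2.1
  have hinj : ∀ (N : ModuleCat.{0} R) [Module.Finite R N], ∀ n > d,
      Subsingleton (Abelian.Ext N (ModuleCat.of R ω) n) := fun N _ n hn ↦
    subsingleton_ext_of_injectiveDimension_lt_top hdim ((le_rdepth_iff d R).1 hCM)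
      (fun N _ n hn ↦ (subsingleton_ext1_iff_subsingleton_ext n N ω).1 (hr N n hn)) N n hn
  exact subsingleton_ext_of_depth hinj d (ModuleCat.of R Z) ((le_rdepth_iff d Z).1 hZ.2)
    (i + 1) (by lia)

theorem IsMCM.dual [IsNoetherianRing R] [IsLocalRing R] {d : ℕ}
    (hdim : ringKrullDim R = d) (hCM : (d : ℕ∞) ≤ rdepth R R) {ω : Type} [AddCommGroup ω]
    [Module R ω] (hω : IsCanonicalModule R d ω) {Z : Type} [AddCommGroup Z] [Module R Z]
    (hZ : IsMCM R d Z) : IsMCM R d (Z →ₗ[R] ω) := by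
  have : Module.Finite R ω := hω.1.1
  have : Module.Finite R Z := hZ.1
  exact ⟨inferInstance, (le_rdepth_iff _ _).2 <| subsingleton_ext_dual ω _
    ((le_rdepth_iff _ _).1 hω.1.2) Z (hZ.subsingleton_ext hdim hCM hω)⟩

end CohenMacaulay

/-- if `μ : M → X` is a special CM-preenvelope, then `μ† : X† → M†` is a
special CM-precover. -/
theorem dual_of_special_cm_preenvelope (R : Type) [CommRing R] [IsNoetherianRing R]
    [IsLocalRing R]
    (d : ℕ) (hdim : ringKrullDim R = d) (hCM : (d : ℕ∞) ≤ rdepth R R)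
    (ω : Type) [AddCommGroup ω] [Module R ω] (hω : IsCanonicalModule R d ω)
    (M X : Type) [AddCommGroup M] [Module R M] [AddCommGroup X] [Module R X]
    [Module.Finite R M] (μ : M →ₗ[R] X) (h : IsSpecialCMPreenvelope R d μ) :
    IsSpecialCMPrecover R d (dmap R ω μ) := by
  refine ⟨⟨h.1.1.dual hdim hCM hω, fun Z _ _ hZ f ↦ ?_⟩, fun Z _ _ hZ ↦ ?_⟩
  · obtain ⟨g, hg⟩ := h.1.2 _ (hZ.dual hdim hCM hω) f.flip
    refine ⟨g.flip, ?_⟩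
    ext z x
    exact LinearMap.congr_fun (LinearMap.congr_fun hg x) z
  · have : Module.Finite R Z := hZ.1
    exact (subsingleton_ext1_iff_subsingleton_ext _ _ _).2 <|
      subsingleton_ext_ker_dmap ω μ Z (hZ.subsingleton_ext hdim hCM hω 0) <|
        (subsingleton_ext1_iff_subsingleton_ext _ _ _).1 <|
          h.2 _ (hZ.dual hdim hCM hω)
end
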